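/- arXiv:1208.2588 — 7 statements merged into one kernel-verified Lean document; each statement's English description precedes it below -/
import Mathlib

section
/- Fix n ∈ ℕ, n ≥ 1, let 0 < α < 1 and let x be n-times continuously differentiable on [a,b]. Then for every t ∈ (a,b), ₐD_t^α x(t) = (t−a)^{−α} x(t)/Γ(1−α) + Σ_{i=1}^{n−1} A(α,i) (t−a)^{i−α} x^{(i)}(t) + Σ_{p=n}^∞ [ −(Γ(p−n+1+α)/(Γ(−α)Γ(1+α)(p−n+1)!)) (t−a)^{−α} x(t) + B(α,p) (t−a)^{n−1−p−α} V_p(t) ], where A(α,i) = (1/Γ(i+1−α)) [1 + Σ_{p=n−i}^∞ Γ(p−n+1+α)/(Γ(α−i)(p−n+i+1)!)], B(α,p) = Γ(p−n+1+α)/(Γ(−α)Γ(1+α)(p−n+1)!), and V_p(t) = (p−n+1) ∫_a^t (τ−a)^{p−n} x(τ) dτ; all series appearing converge. -/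
open MeasureTheory Real Nat

open Filter Topology Asymptotics

theorem Real.Gamma_add_natCast_eq_ascPochhammer_mul {s : ℝ} (hs : ∀ m : ℕ, s ≠ -m) (k : ℕ) :
    Real.Gamma (s + k) = (ascPochhammer ℝ k).eval s * Real.Gamma s := by
  induction k with
  | zero => simp
  | succ k ih =>
    have h : s + k ≠ 0 := fun h => hs k (by linarith)
    rw [ascPochhammer_succ_eval, Nat.cast_succ, ← add_assoc, Real.Gamma_add_one h, ih]
    ring

theorem ascPochhammer_eval_eq_prod_range_add (s : ℝ) (n : ℕ) :
    (ascPochhammer ℝ n).eval s = ∏ j ∈ Finset.range n, (s + j) := by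
  induction n with
  | zero => simp
  | succ n ih => rw [ascPochhammer_succ_eval, Finset.prod_range_succ, ih]

theorem Real.ascPochhammer_eval_div_factorial_eventuallyEq (s : ℝ) :
    (fun n : ℕ => (ascPochhammer ℝ (n + 1)).eval s / n !) =ᶠ[atTop]
      fun n : ℕ => (n : ℝ) ^ s * (Real.GammaSeq s n)⁻¹ := by
  filter_upwards [eventually_ge_atTop 1] with n hn
  have h1 : (0 : ℝ) < n := by exact_mod_cast hn
  have h2 : (n : ℝ) ^ s ≠ 0 := (Real.rpow_pos_of_pos h1 s).ne'
  rw [Real.GammaSeq, ascPochhammer_eval_eq_prod_range_add]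
  field_simp

theorem Real.tendsto_inv_GammaSeq {s : ℝ} (hs : ∀ m : ℕ, s ≠ -m) :
    Tendsto (fun n => (Real.GammaSeq s n)⁻¹) atTop (𝓝 (Real.Gamma s)⁻¹) :=
  (Real.GammaSeq_tendsto_Gamma s).inv₀ (Real.Gamma_ne_zero hs)

theorem Real.tendsto_ascPochhammer_eval_div_factorial {s : ℝ} (hs : ∀ m : ℕ, s ≠ -m)
    (hs0 : s < 0) :
    Tendsto (fun n : ℕ => (ascPochhammer ℝ (n + 1)).eval s / n !) atTop (𝓝 0) := by
  refine Tendsto.congr' (ascPochhammer_eval_div_factorial_eventuallyEq s).symm ?_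
  have h := (tendsto_rpow_neg_atTop (neg_pos.2 hs0)).comp
    (tendsto_natCast_atTop_atTop (R := ℝ))
  simpa [Function.comp_def] using h.mul (tendsto_inv_GammaSeq hs)

theorem Real.summable_ascPochhammer_eval_div_factorial {s : ℝ} (hs : ∀ m : ℕ, s ≠ -m)
    (hs0 : s < 0) : Summable fun k : ℕ => (ascPochhammer ℝ k).eval s / k ! := by
  rw [← summable_nat_add_iff 1]
  refine summable_of_isBigO_nat (Real.summable_nat_rpow.2 (by linarith : s - 1 < -1)) ?_
  have h1 : (fun n : ℕ => (ascPochhammer ℝ (n + 1)).eval s / n ! * ((n : ℝ) + 1)⁻¹) =O[atTop]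
      fun n : ℕ => ((n : ℝ) ^ s * 1) * (n : ℝ)⁻¹ := by
    refine IsBigO.mul ?_ ?_
    · refine (ascPochhammer_eval_div_factorial_eventuallyEq s).trans_isBigO ?_
      exact (isBigO_refl _ _).mul ((tendsto_inv_GammaSeq hs).isBigO_one ℝ)
    · refine IsBigO.of_bound 1 ?_
      filter_upwards [eventually_ge_atTop 1] with n hn
      have h1 : (0 : ℝ) < n := by exact_mod_cast hn
      rw [one_mul, norm_inv, norm_inv, Real.norm_of_nonneg h1.le,
        Real.norm_of_nonneg (by linarith)]
      gcongr
      linarith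
  refine (h1.congr_left fun n => ?_).congr' EventuallyEq.rfl ?_
  · rw [Nat.factorial_succ]
    push_cast
    field_simp
  · filter_upwards [eventually_ge_atTop 1] with n hn
    have h1 : (0 : ℝ) < n := by exact_mod_cast hn
    rw [Real.rpow_sub_one h1.ne']
    ring

theorem Real.sum_range_ascPochhammer_eval_div_factorial {s : ℝ} (hs : s ≠ 0) (n : ℕ) :
    ∑ k ∈ Finset.range (n + 1), (ascPochhammer ℝ k).eval s / k ! =
      s⁻¹ * ((ascPochhammer ℝ (n + 1)).eval s / n !) := by
  induction n with
  | zero => simp [hs]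
  | succ n ih =>
    rw [Finset.sum_range_succ, ih, ascPochhammer_succ_eval (n + 1), Nat.factorial_succ]
    push_cast
    field_simp
    ring

/-- The binomial series of `(1 - z) ^ (-s)` with `s < 0` sums to `0` at `z = 1`. -/
theorem Real.hasSum_ascPochhammer_eval_div_factorial {s : ℝ} (hs : ∀ m : ℕ, s ≠ -m)
    (hs0 : s < 0) : HasSum (fun k : ℕ => (ascPochhammer ℝ k).eval s / k !) 0 := by
  have h := summable_ascPochhammer_eval_div_factorial hs hs0
  convert h.hasSum
  refine tendsto_nhds_unique ?_ ((tendsto_add_atTop_iff_nat 1).2 h.hasSum.tendsto_sum_nat)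
  simp_rw [sum_range_ascPochhammer_eval_div_factorial hs0.ne]
  simpa using (tendsto_ascPochhammer_eval_div_factorial hs hs0).const_mul s⁻¹

theorem Real.hasSum_ascPochhammer_mul_pow (s : ℝ) {v : ℝ} (hv : |v| < 1) :
    HasSum (fun k : ℕ => (ascPochhammer ℝ k).eval s / k ! * v ^ k) ((1 - v) ^ (-s)) := by
  have h := (Real.one_div_one_sub_rpow_hasFPowerSeriesOnBall_zero s).hasSum (y := v)
    (by simpa [Metric.mem_eball, edist_dist] using hv)
  rw [zero_add, one_div, ← Real.rpow_neg (by linarith [(abs_lt.1 hv).2])] at h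
  convert! h using 1
  funext k
  have h1 := Ring.factorial_nsmul_multichoose_eq_ascPochhammer s k
  rw [Polynomial.ascPochhammer_smeval_eq_eval, nsmul_eq_mul] at h1
  rw [← h1, FormalMultilinearSeries.ofScalars_apply_eq, Ring.choose, smul_eq_mul,
    mul_div_cancel_left₀ _ (by positivity)]
  ring_nf

theorem intervalIntegrable_one_sub_rpow_neg {α : ℝ} (hα : α < 1) :
    IntervalIntegrable (fun v : ℝ => (1 - v) ^ (-α)) volume 0 1 := by
  have h := (intervalIntegral.intervalIntegrable_rpow' (a := 1) (b := 0)
    (by linarith : -1 < -α)).comp_sub_left 1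
  simpa using h

theorem hasSum_integral_pow_mul_of_continuousOn {α : ℝ} (hα0 : 0 < α) (hα1 : α < 1) {g : ℝ → ℝ}
    (hg : ContinuousOn g (Set.Icc 0 1)) :
    HasSum (fun k : ℕ => (ascPochhammer ℝ k).eval α / k ! * ∫ v in (0 : ℝ)..1, v ^ k * g v)
      (∫ v in (0 : ℝ)..1, (1 - v) ^ (-α) * g v) := by
  obtain ⟨M, hM⟩ := isCompact_Icc.exists_bound_of_continuousOn hg
  have hne : ∀ᵐ v : ℝ, v ≠ 1 := Measure.ae_ne volume 1
  have hbinom : ∀ v ∈ Set.Ioc (0 : ℝ) 1, v ≠ 1 →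
      HasSum (fun k : ℕ => (ascPochhammer ℝ k).eval α / k ! * v ^ k) ((1 - v) ^ (-α)) :=
    fun v hv hv1 => Real.hasSum_ascPochhammer_mul_pow α
      (abs_lt.2 ⟨by linarith [hv.1], lt_of_le_of_ne hv.2 hv1⟩)
  simp_rw [← intervalIntegral.integral_const_mul]
  refine intervalIntegral.hasSum_integral_of_dominated_convergence
    (fun k v => (ascPochhammer ℝ k).eval α / k ! * v ^ k * M) ?_ ?_ ?_ ?_ ?_
  · intro k
    rw [Set.uIoc_of_le zero_le_one]
    refine ContinuousOn.aestronglyMeasurable ?_ measurableSet_Ioc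
    exact continuousOn_const.mul
      ((continuous_pow k).continuousOn.mul (hg.mono Set.Ioc_subset_Icc_self))
  · refine fun k => ae_of_all _ fun v hv => ?_
    rw [Set.uIoc_of_le zero_le_one] at hv
    have h1 := ascPochhammer_pos k α hα0
    have h2 := hv.1
    rw [← mul_assoc, norm_mul, Real.norm_of_nonneg (by positivity)]
    exact mul_le_mul_of_nonneg_left (hM v ⟨hv.1.le, hv.2⟩) (by positivity)
  · filter_upwards [hne] with v hv1 hv
    rw [Set.uIoc_of_le zero_le_one] at hv
    exact (hbinom v hv hv1).summable.mul_right M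
  · refine ((intervalIntegrable_one_sub_rpow_neg hα1).mul_const M).congr_ae ?_
    rw [Set.uIoc_of_le zero_le_one, EventuallyEq, ae_restrict_iff' measurableSet_Ioc]
    filter_upwards [hne] with v hv1 hv
    exact ((hbinom v hv hv1).mul_right M).tsum_eq.symm
  · filter_upwards [hne] with v hv1 hv
    rw [Set.uIoc_of_le zero_le_one] at hv
    simpa [mul_assoc] using (hbinom v hv hv1).mul_right (g v)

theorem integral_pow_succ_mul_deriv {y y' : ℝ → ℝ} (hy : ContinuousOn y (Set.Icc 0 1))
    (hy' : ContinuousOn y' (Set.Icc 0 1)) (hd : ∀ v ∈ Set.Ioo (0 : ℝ) 1, HasDerivAt y (y' v) v)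
    (q : ℕ) :
    ∫ v in (0 : ℝ)..1, v ^ (q + 1) * y' v =
      y 1 - ((q : ℝ) + 1) * ∫ v in (0 : ℝ)..1, v ^ q * y v := by
  rw [← Set.uIcc_of_le (zero_le_one (α := ℝ))] at hy hy'
  rw [intervalIntegral.integral_mul_deriv_eq_deriv_mul_of_hasDerivAt
    (u' := fun v => ((q : ℝ) + 1) * v ^ q) (by fun_prop) hy ?_ (by simpa using hd)
    (by apply Continuous.intervalIntegrable; fun_prop) hy'.intervalIntegrable,
    ← intervalIntegral.integral_const_mul]
  · simp [mul_assoc]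
  · intro v _
    simpa using hasDerivAt_pow (q + 1) v

theorem integral_one_sub_rpow_mul_deriv {α : ℝ} (hα1 : α < 1) {y y' : ℝ → ℝ}
    (hy : ContinuousOn y (Set.Icc 0 1)) (hy' : ContinuousOn y' (Set.Icc 0 1))
    (hd : ∀ v ∈ Set.Ioo (0 : ℝ) 1, HasDerivAt y (y' v) v) :
    ∫ v in (0 : ℝ)..1, (1 - v) ^ (1 - α) * y' v =
      (1 - α) * (∫ v in (0 : ℝ)..1, (1 - v) ^ (-α) * y v) - y 0 := by
  rw [← Set.uIcc_of_le (zero_le_one (α := ℝ))] at hy hy'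
  rw [intervalIntegral.integral_mul_deriv_eq_deriv_mul_of_hasDerivAt
    (u' := fun v => -((1 - α) * (1 - v) ^ (-α))) ?_ hy ?_ (by simpa using hd)
    ((intervalIntegrable_one_sub_rpow_neg hα1).const_mul _).neg hy'.intervalIntegrable,
    ← intervalIntegral.integral_const_mul]
  · simp [mul_assoc, Real.zero_rpow (by linarith : 1 - α ≠ 0)]
    ring
  · exact ContinuousOn.rpow_const (by fun_prop) fun _ _ => Or.inr (by linarith)
  · intro v hv
    simp only [zero_le_one, inf_of_le_left, sup_of_le_right, Set.mem_Ioo] at hv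
    convert! ((hasDerivAt_id v).const_sub 1).rpow_const (p := 1 - α)
      (Or.inl (sub_pos.2 hv.2).ne') using 1
    simp
    ring

theorem one_sub_mul_integral_add_integral_eq {α : ℝ} (hα1 : α < 1) {y y' : ℝ → ℝ}
    (hy : ContinuousOn y (Set.Icc 0 1)) (hy' : ContinuousOn y' (Set.Icc 0 1))
    (hd : ∀ v ∈ Set.Ioo (0 : ℝ) 1, HasDerivAt y (y' v) v) :
    (1 - α) * (∫ v in (0 : ℝ)..1, (1 - v) ^ (-α) * y v) +
        ∫ v in (0 : ℝ)..1, (1 - v) ^ (-α) * (v * y' v) =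
      y 0 + ∫ v in (0 : ℝ)..1, (1 - v) ^ (-α) * y' v := by
  have h := integral_one_sub_rpow_mul_deriv hα1 hy hy' hd
  have hi := intervalIntegrable_one_sub_rpow_neg hα1
  rw [← Set.uIcc_of_le (zero_le_one (α := ℝ))] at hy'
  have hsplit : ∫ v in (0 : ℝ)..1, (1 - v) ^ (1 - α) * y' v =
      (∫ v in (0 : ℝ)..1, (1 - v) ^ (-α) * y' v) -
        ∫ v in (0 : ℝ)..1, (1 - v) ^ (-α) * (v * y' v) := by
    rw [← intervalIntegral.integral_sub (hi.mul_continuousOn hy')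
      (hi.mul_continuousOn (g := fun v => v * y' v) (continuousOn_id.mul hy'))]
    refine intervalIntegral.integral_congr_ae ?_
    filter_upwards [Measure.ae_ne volume (1 : ℝ)] with v hv1 hv
    rw [Set.uIoc_of_le zero_le_one] at hv
    rw [show 1 - α = -α + 1 by ring,
      Real.rpow_add_one (sub_pos.2 (lt_of_le_of_ne hv.2 hv1)).ne']
    ring
  linarith

theorem hasSum_ascPochhammer_mul_sub_moment {α : ℝ} (hα0 : 0 < α) (hα1 : α < 1) {y y' : ℝ → ℝ}
    (hy : ContinuousOn y (Set.Icc 0 1)) (hy' : ContinuousOn y' (Set.Icc 0 1))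
    (hd : ∀ v ∈ Set.Ioo (0 : ℝ) 1, HasDerivAt y (y' v) v) :
    HasSum (fun q : ℕ => (ascPochhammer ℝ (q + 1)).eval α / (q + 1)! *
        (y 1 - ((q : ℝ) + 1) * ∫ v in (0 : ℝ)..1, v ^ q * y v))
      ((1 - α) * (∫ v in (0 : ℝ)..1, (1 - v) ^ (-α) * y v) +
        (∫ v in (0 : ℝ)..1, (1 - v) ^ (-α) * (v * y' v)) - y 1) := by
  have h := (hasSum_nat_add_iff' 1).2 (hasSum_integral_pow_mul_of_continuousOn hα0 hα1 hy')
  simp_rw [integral_pow_succ_mul_deriv hy hy' hd] at h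
  have h0 : ∫ v in (0 : ℝ)..1, y' v = y 1 - y 0 :=
    intervalIntegral.integral_eq_sub_of_hasDerivAt_of_le zero_le_one hy hd
      (ContinuousOn.intervalIntegrable_of_Icc zero_le_one hy')
  rw [one_sub_mul_integral_add_integral_eq hα1 hy hy' hd]
  convert! h using 1
  simp [h0]
  ring

theorem intervalIntegral_eq_sub_mul_integral_unit (f : ℝ → ℝ) (a s : ℝ) :
    ∫ τ in a..s, f τ = (s - a) * ∫ v in (0 : ℝ)..1, f (a + (s - a) * v) := by
  simp

theorem integral_sub_rpow_neg_mul_eq {α a s : ℝ} (has : a < s) (x : ℝ → ℝ) :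
    ∫ τ in a..s, (s - τ) ^ (-α) * x τ =
      (s - a) ^ (1 - α) * ∫ v in (0 : ℝ)..1, (1 - v) ^ (-α) * x (a + (s - a) * v) := by
  have hs := sub_pos.2 has
  rw [intervalIntegral_eq_sub_mul_integral_unit, show 1 - α = -α + 1 by ring,
    Real.rpow_add_one hs.ne', mul_comm _ (s - a), mul_assoc,
    ← intervalIntegral.integral_const_mul ((s - a) ^ (-α))]
  congr 1
  refine intervalIntegral.integral_congr fun v hv => ?_
  rw [Set.uIcc_of_le zero_le_one] at hv
  rw [show s - (a + (s - a) * v) = (s - a) * (1 - v) by ring,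
    Real.mul_rpow hs.le (sub_nonneg.2 hv.2), mul_assoc]

theorem integral_sub_pow_mul_eq (a t : ℝ) (q : ℕ) (x : ℝ → ℝ) :
    ∫ τ in a..t, (τ - a) ^ q * x τ =
      (t - a) ^ (q + 1) * ∫ v in (0 : ℝ)..1, v ^ q * x (a + (t - a) * v) := by
  rw [intervalIntegral_eq_sub_mul_integral_unit, _root_.pow_succ', mul_assoc,
    ← intervalIntegral.integral_const_mul ((t - a) ^ q)]
  simp [mul_pow, mul_assoc]

theorem mapsTo_add_sub_mul_Icc {a b s : ℝ} (hs : s ∈ Set.Icc a b) :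
    Set.MapsTo (fun v : ℝ => a + (s - a) * v) (Set.Icc 0 1) (Set.Icc a b) := fun v hv =>
  ⟨by nlinarith [hs.1, hv.1, mul_nonneg (sub_nonneg.2 hs.1) hv.1],
    by nlinarith [hs.2, mul_nonneg (sub_nonneg.2 hs.1) (sub_nonneg.2 hv.2)]⟩

theorem add_sub_mul_mem_Ioo {a b s v : ℝ} (hs : s ∈ Set.Ioo a b) (hv : v ∈ Set.Ioc (0 : ℝ) 1) :
    a + (s - a) * v ∈ Set.Ioo a b :=
  ⟨by nlinarith [mul_pos (sub_pos.2 hs.1) hv.1],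
    by nlinarith [hs.2, mul_nonneg (sub_pos.2 hs.1).le (sub_nonneg.2 hv.2)]⟩

theorem hasDerivAt_integral_one_sub_rpow_mul {α a b t : ℝ} (hα1 : α < 1) (ht : t ∈ Set.Ioo a b)
    {x x' : ℝ → ℝ} (hx : ContinuousOn x (Set.Icc a b)) (hx' : ContinuousOn x' (Set.Icc a b))
    (hd : ∀ τ ∈ Set.Ioo a b, HasDerivAt x (x' τ) τ) :
    HasDerivAt (fun s => ∫ v in (0 : ℝ)..1, (1 - v) ^ (-α) * x (a + (s - a) * v))
      (∫ v in (0 : ℝ)..1, (1 - v) ^ (-α) * (v * x' (a + (t - a) * v))) t := by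
  obtain ⟨M, hM⟩ := isCompact_Icc.exists_bound_of_continuousOn hx'
  have hi := intervalIntegrable_one_sub_rpow_neg hα1
  have hcomp : ∀ {f : ℝ → ℝ} {s : ℝ}, ContinuousOn f (Set.Icc a b) → s ∈ Set.Ioo a b →
      ContinuousOn (fun v => f (a + (s - a) * v)) (Set.uIcc 0 1) := fun hf hs => by
    rw [Set.uIcc_of_le zero_le_one]
    exact hf.comp (by fun_prop) (mapsTo_add_sub_mul_Icc (Set.Ioo_subset_Icc_self hs))
  have hnhds : Set.Ioo a b ∈ 𝓝 t := Ioo_mem_nhds ht.1 ht.2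
  refine (intervalIntegral.hasDerivAt_integral_of_dominated_loc_of_deriv_le
    (F' := fun s v => (1 - v) ^ (-α) * (v * x' (a + (s - a) * v)))
    (bound := fun v => (1 - v) ^ (-α) * M) hnhds ?_ ?_ ?_ ?_ (hi.mul_const M) ?_).2
  · filter_upwards [hnhds] with s hs
    exact (hi.mul_continuousOn (hcomp hx hs)).def'.aestronglyMeasurable
  · exact hi.mul_continuousOn (hcomp hx ht)
  · exact (hi.mul_continuousOn (continuousOn_id.mul (hcomp hx' ht))).def'.aestronglyMeasurable
  · refine ae_of_all _ fun v hv s hs => ?_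
    rw [Set.uIoc_of_le zero_le_one] at hv
    have h1 := hM _ (Set.Ioo_subset_Icc_self (add_sub_mul_mem_Ioo hs hv))
    have h2 := Real.rpow_nonneg (sub_nonneg.2 hv.2) (-α)
    rw [norm_mul, norm_mul, Real.norm_of_nonneg h2, Real.norm_of_nonneg hv.1.le]
    refine mul_le_mul_of_nonneg_left ?_ h2
    exact (mul_le_of_le_one_left (norm_nonneg _) hv.2).trans h1
  · refine ae_of_all _ fun v hv s hs => ?_
    rw [Set.uIoc_of_le zero_le_one] at hv
    have h1 : HasDerivAt (fun s => a + (s - a) * v) v s := by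
      simpa using (((hasDerivAt_id s).sub_const a).mul_const v).const_add a
    have h2 := ((hd _ (add_sub_mul_mem_Ioo hs hv)).comp s h1).const_mul ((1 - v) ^ (-α))
    simpa [Function.comp_def, mul_comm v] using h2

theorem deriv_integral_sub_rpow_neg_mul {α a b t : ℝ} (hα1 : α < 1) (ht : t ∈ Set.Ioo a b)
    {x x' : ℝ → ℝ} (hx : ContinuousOn x (Set.Icc a b)) (hx' : ContinuousOn x' (Set.Icc a b))
    (hd : ∀ τ ∈ Set.Ioo a b, HasDerivAt x (x' τ) τ) :
    deriv (fun s => ∫ τ in a..s, (s - τ) ^ (-α) * x τ) t =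
      (t - a) ^ (-α) * ((1 - α) * (∫ v in (0 : ℝ)..1, (1 - v) ^ (-α) * x (a + (t - a) * v)) +
        ∫ v in (0 : ℝ)..1, (1 - v) ^ (-α) * (v * ((t - a) * x' (a + (t - a) * v)))) := by
  have hta := (sub_pos.2 ht.1).ne'
  have heq : (fun s => ∫ τ in a..s, (s - τ) ^ (-α) * x τ) =ᶠ[𝓝 t] fun s =>
      (s - a) ^ (1 - α) * ∫ v in (0 : ℝ)..1, (1 - v) ^ (-α) * x (a + (s - a) * v) := by
    filter_upwards [Ioi_mem_nhds ht.1] with s hs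
    exact integral_sub_rpow_neg_mul_eq hs x
  have h1 : HasDerivAt (fun s => (s - a) ^ (1 - α)) ((1 - α) * (t - a) ^ (-α)) t := by
    convert! ((hasDerivAt_id t).sub_const a).rpow_const (p := 1 - α) (Or.inl hta) using 1
    simp
  have h2 := h1.fun_mul (hasDerivAt_integral_one_sub_rpow_mul hα1 ht hx hx' hd)
  rw [heq.deriv_eq, h2.deriv, show 1 - α = -α + 1 by ring, Real.rpow_add_one hta, mul_add, mul_assoc _ (t - a),
    ← intervalIntegral.integral_const_mul (t - a)]
  congr 1
  · ring
  · congr 2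
    funext v
    ring

theorem hasSum_Gamma_div_Gamma_mul_factorial {s : ℝ} (hs : ∀ m : ℕ, s ≠ -m) (hs0 : s < 0) :
    HasSum (fun q : ℕ => Real.Gamma (s + (q + 1 : ℕ)) / (Real.Gamma s * ((q + 1)! : ℝ))) (-1) := by
  have h := (hasSum_nat_add_iff' 1).2 (Real.hasSum_ascPochhammer_eval_div_factorial hs hs0)
  convert! h using 1
  · funext q
    rw [Real.Gamma_add_natCast_eq_ascPochhammer_mul hs]
    have := Real.Gamma_ne_zero hs
    field_simp
  · simp

theorem Gamma_add_one_add_div_eq {α : ℝ} (hα0 : 0 < α) (hα1 : α < 1) (q : ℕ) :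
    Real.Gamma ((q : ℝ) + 1 + α) /
        (Real.Gamma (-α) * Real.Gamma (1 + α) * ((q + 1)! : ℝ)) =
      -((Real.Gamma (1 - α))⁻¹ * ((ascPochhammer ℝ (q + 1)).eval α / ((q + 1)! : ℝ))) := by
  have h1 := Real.Gamma_add_natCast_eq_ascPochhammer_mul (s := α)
    (fun m => by have := m.cast_nonneg (α := ℝ); linarith) (q + 1)
  have h2 : Real.Gamma (1 - α) = -α * Real.Gamma (-α) := by
    rw [← Real.Gamma_add_one (by linarith : -α ≠ 0)]
    congr 1
    ring
  have h3 : Real.Gamma (1 + α) = α * Real.Gamma α := by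
    rw [← Real.Gamma_add_one hα0.ne', add_comm]
  have h4 := (Real.Gamma_pos_of_pos hα0).ne'
  have h5 : Real.Gamma (-α) ≠ 0 := fun h =>
    (Real.Gamma_pos_of_pos (sub_pos.2 hα1)).ne' (by rw [h2, h, mul_zero])
  rw [show (q : ℝ) + 1 + α = α + (q + 1 : ℕ) by push_cast; ring, h1, h2, h3]
  field_simp

/-- Generalized moment expansion of the left Riemann–Liouville fractional
derivative of an `n`-times continuously differentiable function.  The series
over `p ≥ n - i` (in `A(α,i)`) and `p ≥ n` are reindexed by `q = p - (n - i)`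
and `q = p - n` respectively. -/
theorem rl_deriv_generalized_moment_expansion
    (n : ℕ) (hn : 1 ≤ n) (a b α : ℝ) (hab : a < b) (hα0 : 0 < α) (hα1 : α < 1)
    (x : ℝ → ℝ) (hx : ContDiffOn ℝ n x (Set.Icc a b))
    (t : ℝ) (ht : t ∈ Set.Ioo a b) :
    (∀ i : ℕ, 1 ≤ i → i ≤ n - 1 →
      Summable (fun q : ℕ =>
        Real.Gamma ((q : ℝ) + 1 + α - (i : ℝ)) /
          (Real.Gamma (α - (i : ℝ)) * ((q + 1)! : ℝ)))) ∧
    HasSum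
      (fun q : ℕ =>
        -(Real.Gamma ((q : ℝ) + 1 + α) /
            (Real.Gamma (-α) * Real.Gamma (1 + α) * ((q + 1)! : ℝ))) *
            (t - a) ^ (-α) * x t +
          Real.Gamma ((q : ℝ) + 1 + α) /
              (Real.Gamma (-α) * Real.Gamma (1 + α) * ((q + 1)! : ℝ)) *
            (t - a) ^ ((n : ℝ) - 1 - ((n : ℝ) + (q : ℝ)) - α) *
            (((q : ℝ) + 1) * ∫ τ in a..t, (τ - a) ^ q * x τ))
      ((Real.Gamma (1 - α))⁻¹ *
          deriv (fun s => ∫ τ in a..s, (s - τ) ^ (-α) * x τ) t -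
        ((t - a) ^ (-α) * x t / Real.Gamma (1 - α) +
          ∑ i ∈ Finset.Icc 1 (n - 1),
            (1 / Real.Gamma ((i : ℝ) + 1 - α) *
                (1 + ∑' q : ℕ,
                  Real.Gamma ((q : ℝ) + 1 + α - (i : ℝ)) /
                    (Real.Gamma (α - (i : ℝ)) * ((q + 1)! : ℝ)))) *
              (t - a) ^ ((i : ℝ) - α) *
              iteratedDerivWithin i x (Set.Icc a b) t)) := by
  have hsub : ∀ i : ℕ, 1 ≤ i → HasSum (fun q : ℕ => Real.Gamma ((q : ℝ) + 1 + α - (i : ℝ)) /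
      (Real.Gamma (α - (i : ℝ)) * ((q + 1)! : ℝ))) (-1) := fun i hi => by
    have hi' : (1 : ℝ) ≤ i := by exact_mod_cast hi
    have hne : ∀ m : ℕ, α - (i : ℝ) ≠ -m := fun m h => by
      have h1 : (m : ℝ) < i := by linarith
      have h2 : (i : ℝ) < m + 1 := by linarith
      norm_cast at h1 h2
      lia
    convert! hasSum_Gamma_div_Gamma_mul_factorial hne (by linarith) using 4
    push_cast
    ring
  refine ⟨fun i hi _ => (hsub i hi).summable, ?_⟩
  rw [Finset.sum_eq_zero fun i hi => by
    rw [(hsub i (Finset.mem_Icc.1 hi).1).tsum_eq]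
    ring]
  have hn' : (1 : WithTop ℕ∞) ≤ n := by exact_mod_cast hn
  have hxc := hx.continuousOn
  have hxd := hx.continuousOn_derivWithin (uniqueDiffOn_Icc hab) hn'
  have hd : ∀ τ ∈ Set.Ioo a b, HasDerivAt x (derivWithin x (Set.Icc a b) τ) τ := fun τ hτ =>
    ((hx.differentiableOn (by positivity)) τ
      (Set.Ioo_subset_Icc_self hτ)).hasDerivWithinAt.hasDerivAt (Icc_mem_nhds hτ.1 hτ.2)
  have hta := sub_pos.2 ht.1
  have hmaps := mapsTo_add_sub_mul_Icc (Set.Ioo_subset_Icc_self ht)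
  have hsum := hasSum_ascPochhammer_mul_sub_moment hα0 hα1
    (y := fun v => x (a + (t - a) * v))
    (y' := fun v => (t - a) * derivWithin x (Set.Icc a b) (a + (t - a) * v))
    (hxc.comp (by fun_prop) hmaps) (continuousOn_const.mul (hxd.comp (by fun_prop) hmaps))
    fun v hv => by
      have h1 : HasDerivAt (fun v => a + (t - a) * v) (t - a) v := by
        simpa using ((hasDerivAt_id v).const_mul (t - a)).const_add a
      simpa [Function.comp_def, mul_comm (t - a)] using
        (hd _ (add_sub_mul_mem_Ioo ht ⟨hv.1, hv.2.le⟩)).comp v h1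
  have hfinal := hsum.mul_left ((Real.Gamma (1 - α))⁻¹ * (t - a) ^ (-α))
  have ht1 : a + (t - a) * 1 = t := by ring
  rw [deriv_integral_sub_rpow_neg_mul hα1 ht hxc hxd hd]
  rw [ht1] at hfinal
  convert! hfinal using 1
  · funext q
    rw [Gamma_add_one_add_div_eq hα0 hα1, integral_sub_pow_mul_eq,
      show (n : ℝ) - 1 - ((n : ℝ) + (q : ℝ)) - α = -α - (q + 1 : ℕ) by push_cast; ring,
      Real.rpow_sub_natCast hta.ne']
    field_simp
    ring
  · ring
end

section
/- For every real number α with 0 < α < 1 and every integer p ≥ 1, | Γ(p−1+α) / (Γ(α−1) p!) | ≤ e^{(1−α)² + (1−α)} / p^{2−α}; equivalently, the absolute value of the generalized binomial coefficient binom(1−α, p) is bounded by e^{(1−α)² + (1−α)} / p^{2−α}. -/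
open Real Nat

/-- A consequence of Bernoulli's inequality: `(x - s) (x + 1)^s ≤ x^s x` for `0 ≤ s ≤ 1`. -/
theorem sub_mul_add_one_rpow_le {x s : ℝ} (hx : 0 < x) (hs0 : 0 ≤ s) (hs1 : s ≤ 1)
    (hsx : s ≤ x) : (x - s) * (x + 1) ^ s ≤ x ^ s * x := by
  have bernoulli : (1 + 1 / x) ^ s ≤ 1 + s * (1 / x) :=
    rpow_one_add_le_one_add_mul_self (by linarith [one_div_pos.2 hx]) hs0 hs1
  have hsplit : (x + 1) ^ s = x ^ s * (1 + 1 / x) ^ s := by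
    rw [← Real.mul_rpow hx.le (by positivity)]
    congr 1
    field_simp
  have hprod : (x - s) * (1 + s * (1 / x)) ≤ x := by
    have : (x - s) * (1 + s * (1 / x)) = x - s ^ 2 / x := by field_simp; ring
    rw [this]
    linarith [div_nonneg (sq_nonneg s) hx.le]
  calc (x - s) * (x + 1) ^ s = x ^ s * ((x - s) * (1 + 1 / x) ^ s) := by rw [hsplit]; ring
    _ ≤ x ^ s * ((x - s) * (1 + s * (1 / x))) := by
      have := sub_nonneg.2 hsx
      gcongr
    _ ≤ x ^ s * x := by gcongr

/-- The bound `|binom(1 - α, n + 1)| ≤ (n + 1)^(-(2 - α))`, without the exponential factor. -/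
theorem abs_Gamma_div_mul_rpow_le_one {α : ℝ} (hα0 : 0 < α) (hα1 : α < 1) (n : ℕ) :
    |Gamma (n + α) / (Gamma (α - 1) * ((n + 1)! : ℝ))| * ((n : ℝ) + 1) ^ (2 - α) ≤ 1 := by
  induction n with
  | zero =>
    have hrec : Gamma α = (α - 1) * Gamma (α - 1) := by
      simpa using Gamma_add_one (s := α - 1) (by linarith)
    have hne : Gamma (α - 1) ≠ 0 := fun h => (Gamma_pos_of_pos hα0).ne' (by rw [hrec, h, mul_zero])
    have : Gamma α / Gamma (α - 1) = α - 1 := by rw [hrec, mul_div_cancel_right₀ _ hne]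
    simp only [CharP.cast_eq_zero, zero_add, factorial_one, cast_one, mul_one, one_rpow, this]
    exact abs_le.2 ⟨by linarith, by linarith⟩
  | succ n ih =>
    have hn : (0 : ℝ) ≤ n := n.cast_nonneg
    have hquot : Gamma ((n + 1 : ℕ) + α) / (Gamma (α - 1) * ((n + 1 + 1)! : ℝ)) =
        (n + α) / (n + 1 + 1) * (Gamma (n + α) / (Gamma (α - 1) * ((n + 1)! : ℝ))) := by
      have hrec : Gamma ((n + 1 : ℕ) + α) = (n + α) * Gamma (n + α) := by
        rw [← Gamma_add_one (by positivity)]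
        push_cast
        ring_nf
      rw [hrec, factorial_succ (n + 1), _root_.div_mul_div_comm]
      push_cast
      ring_nf
    have hpow : ∀ x : ℝ, 0 < x → x ^ (2 - α) = x ^ (1 - α) * x := fun x hx => by
      rw [← rpow_add_one hx.ne']
      ring_nf
    have hstep : (n + α) / (n + 1 + 1) * ((n : ℝ) + 1 + 1) ^ (2 - α) ≤
        ((n : ℝ) + 1) ^ (2 - α) := by
      rw [hpow _ (by positivity), hpow _ (by positivity)]
      have := sub_mul_add_one_rpow_le (x := (n : ℝ) + 1) (s := 1 - α) (by positivity)
        (by linarith) (by linarith) (by linarith)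
      convert this using 1
      field_simp
      ring
    rw [hquot, abs_mul, abs_of_nonneg (by positivity : (0 : ℝ) ≤ (n + α) / (n + 1 + 1))]
    push_cast
    refine le_trans ?_ ih
    rw [mul_right_comm, mul_comm]
    gcongr

/-- Bound on the generalized binomial coefficient:
`|Γ(p-1+α)/(Γ(α-1) p!)| ≤ e^{(1-α)² + (1-α)} / p^{2-α}` for `0 < α < 1`
and integers `p ≥ 1`. -/
theorem generalized_binomial_coefficient_bound
    (α : ℝ) (hα0 : 0 < α) (hα1 : α < 1) (p : ℕ) (hp : 1 ≤ p) :
    |Real.Gamma ((p : ℝ) - 1 + α) / (Real.Gamma (α - 1) * (p ! : ℝ))| ≤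
      Real.exp ((1 - α) ^ 2 + (1 - α)) / (p : ℝ) ^ (2 - α) := by
  obtain ⟨n, rfl⟩ := Nat.exists_eq_add_of_le' hp
  rw [le_div_iff₀ (by positivity)]
  have hbound := abs_Gamma_div_mul_rpow_le_one hα0 hα1 n
  have hexp : 1 ≤ Real.exp ((1 - α) ^ 2 + (1 - α)) :=
    one_le_exp (by linarith [sq_nonneg (1 - α)])
  push_cast
  rw [add_sub_cancel_right]
  exact hbound.trans hexp
end

section
/- Let 0 < α < 1, N ≥ 1 an integer, a < t, and for τ ∈ [a,t] set R_N(τ) = Σ_{p=N+1}^∞ (Γ(p−1+α)/(Γ(α−1) p!)) ((τ−a)/(t−a))^p. Then for every τ ∈ [a,t] the series defining R_N(τ) converges absolutely and |R_N(τ)| ≤ e^{(1−α)² + (1−α)} / ((1−α) N^{1−α}). -/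
open Real Nat

/-- The coefficient `Γ(n+α)/(Γ(α) n!)`, the absolute value of the sum of the terms of degree `> n`
in the binomial series of
`(1 - x)^(1-α)` at `x = 1`. -/
noncomputable def binomialTail (α : ℝ) (n : ℕ) : ℝ :=
  Real.Gamma (n + α) / (Real.Gamma α * (n ! : ℝ))

lemma binomialTail_zero {α : ℝ} (hα : 0 < α) : binomialTail α 0 = 1 := by
  have := (Real.Gamma_pos_of_pos hα).ne'
  simp [binomialTail, this]

lemma binomialTail_nonneg {α : ℝ} (hα : 0 < α) (n : ℕ) : 0 ≤ binomialTail α n := by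
  have h1 := Real.Gamma_pos_of_pos hα
  have h2 := Real.Gamma_pos_of_pos (show 0 < (n : ℝ) + α by positivity)
  unfold binomialTail
  positivity

lemma binomialTail_succ {α : ℝ} (hα : 0 < α) (n : ℕ) :
    binomialTail α (n + 1) = binomialTail α n * ((n + α) / (n + 1)) := by
  have h1 := (Real.Gamma_pos_of_pos hα).ne'
  have h2 : (n : ℝ) + α ≠ 0 := by positivity
  have h3 : (n ! : ℝ) ≠ 0 := by positivity
  have h4 : (n : ℝ) + 1 ≠ 0 := by positivity
  have h5 : ((n + 1 : ℕ) : ℝ) + α = (n + α) + 1 := by push_cast; ring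
  unfold binomialTail
  rw [h5, Real.Gamma_add_one h2, Nat.factorial_succ]
  push_cast
  field_simp

lemma binomialTail_sub_succ {α : ℝ} (hα : 0 < α) (n : ℕ) :
    binomialTail α n - binomialTail α (n + 1) = binomialTail α n * ((1 - α) / (n + 1)) := by
  have h : (n : ℝ) + 1 ≠ 0 := by positivity
  rw [binomialTail_succ hα]
  field_simp
  ring

lemma Gamma_div_eq_binomialTail_sub {α : ℝ} (hα0 : 0 < α) (hα1 : α < 1) (n : ℕ) :
    Real.Gamma (n + α) / (Real.Gamma (α - 1) * ((n + 1)! : ℝ)) =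
      -(binomialTail α n - binomialTail α (n + 1)) := by
  have h1 : α - 1 ≠ 0 := by linarith
  have h2 : Real.Gamma α = (α - 1) * Real.Gamma (α - 1) := by
    simpa using Real.Gamma_add_one h1
  have h3 : Real.Gamma (α - 1) ≠ 0 := by
    intro h
    rw [h, mul_zero] at h2
    exact (Real.Gamma_pos_of_pos hα0).ne' h2
  have h4 : (n ! : ℝ) ≠ 0 := by positivity
  have h5 : (n : ℝ) + 1 ≠ 0 := by positivity
  rw [binomialTail_sub_succ hα0, binomialTail, h2, Nat.factorial_succ]
  push_cast
  field_simp
  ring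

lemma binomialTail_mul_rpow_le_one {α : ℝ} (hα0 : 0 < α) (hα1 : α < 1) (n : ℕ) :
    binomialTail α n * ((n : ℝ) + 1) ^ (1 - α) ≤ 1 := by
  induction n with
  | zero => simp [binomialTail_zero hα0]
  | succ n ih =>
    have hn : (0 : ℝ) < n + 1 := by positivity
    have hb : ((n + 1 : ℕ) : ℝ) + 1 = (n + 1) * (1 + 1 / (n + 1)) := by
      push_cast; field_simp
    have hbern : (1 + 1 / ((n : ℝ) + 1)) ^ (1 - α) ≤ 1 + (1 - α) * (1 / (n + 1)) :=
      rpow_one_add_le_one_add_mul_self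
        (by have : (0 : ℝ) ≤ 1 / ((n : ℝ) + 1) := by positivity
            linarith) (by linarith) (by linarith)
    have hratio : ((n : ℝ) + α) / (n + 1) = 1 - (1 - α) * (1 / (n + 1)) := by
      field_simp; ring
    have hstep : ((n : ℝ) + α) / (n + 1) * (1 + 1 / ((n : ℝ) + 1)) ^ (1 - α) ≤ 1 :=
      calc _ ≤ ((n : ℝ) + α) / (n + 1) * (1 + (1 - α) * (1 / (n + 1))) := by gcongr
        _ ≤ 1 := by
          rw [hratio]; nlinarith [sq_nonneg ((1 - α) * (1 / ((n : ℝ) + 1)))]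
    rw [binomialTail_succ hα0, hb, Real.mul_rpow hn.le (by positivity)]
    calc _ = (binomialTail α n * ((n : ℝ) + 1) ^ (1 - α)) *
          (((n : ℝ) + α) / (n + 1) * (1 + 1 / ((n : ℝ) + 1)) ^ (1 - α)) := by ring
      _ ≤ 1 := mul_le_one₀ ih (by positivity) hstep

lemma binomialTail_le {α : ℝ} (hα0 : 0 < α) (hα1 : α < 1) {N : ℕ} (hN : 1 ≤ N) :
    binomialTail α N ≤ Real.exp ((1 - α) ^ 2 + (1 - α)) / ((1 - α) * (N : ℝ) ^ (1 - α)) := by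
  have hs : 0 < 1 - α := by linarith
  have hNpos : (0 : ℝ) < N := by exact_mod_cast hN
  have hb := binomialTail_nonneg hα0 N
  rw [le_div_iff₀ (by positivity)]
  calc binomialTail α N * ((1 - α) * (N : ℝ) ^ (1 - α))
      ≤ binomialTail α N * (1 * ((N : ℝ) + 1) ^ (1 - α)) := by
        gcongr <;> linarith
    _ ≤ 1 := by rw [one_mul]; exact binomialTail_mul_rpow_le_one hα0 hα1 N
    _ ≤ _ := Real.one_le_exp (by positivity)

/-- The binomial-series remainder
`R_N(τ) = Σ_{p=N+1}^∞ (Γ(p-1+α)/(Γ(α-1)p!)) ((τ-a)/(t-a))^p`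
converges absolutely and satisfies
`|R_N(τ)| ≤ e^{(1-α)²+(1-α)} / ((1-α) N^{1-α})` for `τ ∈ [a,t]`.
(The series is reindexed by `q = p - (N+1) ∈ ℕ`.) -/
theorem binomial_remainder_bound
    (α : ℝ) (hα0 : 0 < α) (hα1 : α < 1) (N : ℕ) (hN : 1 ≤ N)
    (a t : ℝ) (hat : a < t) (τ : ℝ) (hτ : τ ∈ Set.Icc a t) :
    Summable (fun q : ℕ =>
      |Real.Gamma (((N : ℝ) + 1 + (q : ℝ)) - 1 + α) /
          (Real.Gamma (α - 1) * ((N + 1 + q)! : ℝ)) *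
        ((τ - a) / (t - a)) ^ (N + 1 + q)|) ∧
    |∑' q : ℕ,
        Real.Gamma (((N : ℝ) + 1 + (q : ℝ)) - 1 + α) /
            (Real.Gamma (α - 1) * ((N + 1 + q)! : ℝ)) *
          ((τ - a) / (t - a)) ^ (N + 1 + q)| ≤
      Real.exp ((1 - α) ^ 2 + (1 - α)) / ((1 - α) * (N : ℝ) ^ (1 - α)) := by
  have hx0 : 0 ≤ (τ - a) / (t - a) := div_nonneg (by linarith [hτ.1]) (by linarith)
  have hx1 : (τ - a) / (t - a) ≤ 1 := by
    rw [div_le_one (by linarith)]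
    linarith [hτ.2]
  set f : ℕ → ℝ := fun q : ℕ =>
    Real.Gamma (((N : ℝ) + 1 + (q : ℝ)) - 1 + α) /
        (Real.Gamma (α - 1) * ((N + 1 + q)! : ℝ)) *
      ((τ - a) / (t - a)) ^ (N + 1 + q) with hf
  have hle (q : ℕ) : |f q| ≤ binomialTail α (N + q) - binomialTail α (N + (q + 1)) := by
    have harg : ((N : ℝ) + 1 + (q : ℝ)) - 1 + α = ((N + q : ℕ) : ℝ) + α := by push_cast; ring
    have hd : 0 ≤ binomialTail α (N + q) - binomialTail α (N + q + 1) := by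
      rw [binomialTail_sub_succ hα0]
      exact mul_nonneg (binomialTail_nonneg hα0 _) (div_nonneg (by linarith) (by positivity))
    simp only [hf]
    rw [harg, show N + 1 + q = N + q + 1 by ring, Gamma_div_eq_binomialTail_sub hα0 hα1,
      abs_mul, abs_neg, abs_of_nonneg hd, abs_of_nonneg (pow_nonneg hx0 _)]
    exact mul_le_of_le_one_right hd (pow_le_one₀ hx0 hx1)
  have hsum (n : ℕ) : ∑ q ∈ Finset.range n, |f q| ≤ binomialTail α N :=
    calc ∑ q ∈ Finset.range n, |f q|
        ≤ ∑ q ∈ Finset.range n, (binomialTail α (N + q) - binomialTail α (N + (q + 1))) :=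
          Finset.sum_le_sum fun q _ => hle q
      _ = binomialTail α N - binomialTail α (N + n) :=
          Finset.sum_range_sub' (fun q => binomialTail α (N + q)) n
      _ ≤ binomialTail α N := sub_le_self _ (binomialTail_nonneg hα0 _)
  have hsummable : Summable fun q => |f q| :=
    summable_of_sum_range_le (fun q => abs_nonneg (f q)) hsum
  refine ⟨hsummable, ?_⟩
  calc |∑' q, f q| ≤ ∑' q, |f q| := by
        simpa only [Real.norm_eq_abs] using norm_tsum_le_tsum_norm (f := f) hsummable
    _ ≤ binomialTail α N := Real.tsum_le_of_sum_range_le (fun q => abs_nonneg (f q)) hsum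
    _ ≤ _ := binomialTail_le hα0 hα1 hN
end

section
/- Let 0 < α < 1, let x be twice continuously differentiable on [a,b], and let N ≥ 1 be an integer. For t ∈ (a,b) define the truncation error E_tr(t) = ((t−a)^{1−α}/Γ(2−α)) ∫_a^t R_N(τ) ẍ(τ) dτ, where R_N(τ) = Σ_{p=N+1}^∞ (Γ(p−1+α)/(Γ(α−1) p!)) ((τ−a)/(t−a))^p. Then |E_tr(t)| ≤ L₂ · e^{(1−α)² + (1−α)} / (Γ(2−α)(1−α) N^{1−α}) · (t−a)^{2−α}, where L₂ = max_{τ∈[a,t]} |ẍ(τ)|. -/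
open MeasureTheory Real Nat

lemma one_le_Gamma_of_le_one {α : ℝ} (hα0 : 0 < α) (hα1 : α ≤ 1) : 1 ≤ Real.Gamma α := by
  have hd : (0 : ℝ) < 2 - α := by linarith
  have h := Real.convexOn_Gamma.2 (Set.mem_Ioi.2 hα0) (Set.mem_Ioi.2 (zero_lt_two (α := ℝ)))
    (show 0 ≤ 1 / (2 - α) by positivity)
    (show 0 ≤ (1 - α) / (2 - α) from div_nonneg (by linarith) hd.le) (by field_simp; ring)
  have h1 : (1 / (2 - α)) • α + ((1 - α) / (2 - α)) • (2 : ℝ) = 1 := by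
    simp only [smul_eq_mul]; field_simp; ring
  rw [h1, Real.Gamma_one, Real.Gamma_two, smul_eq_mul, smul_eq_mul, ← sub_nonneg] at h
  have h2 : 1 / (2 - α) * Real.Gamma α + (1 - α) / (2 - α) * 1 - 1
      = (Real.Gamma α - 1) / (2 - α) := by field_simp; ring
  rw [h2] at h
  by_contra! hc
  exact absurd h (not_le.2 (div_neg_of_neg_of_pos (by linarith) hd))

lemma Gamma_nat_add_div_factorial_le {α : ℝ} (hα0 : 0 < α) (hα1 : α < 1) {N : ℕ} (hN : 1 ≤ N) :
    Real.Gamma (N + α) / (N ! : ℝ) ≤ 1 / (N : ℝ) ^ (1 - α) := by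
  have hNpos : (0 : ℝ) < N := by exact_mod_cast hN
  have h := Real.Gamma_mul_add_mul_le_rpow_Gamma_mul_rpow_Gamma hNpos
    (show (0 : ℝ) < N + 1 by linarith) (show 0 < 1 - α by linarith) hα0 (by ring)
  have hG : 0 < Real.Gamma N := Real.Gamma_pos_of_pos hNpos
  have hf : (N ! : ℝ) = N * Real.Gamma N := by
    rw [← Real.Gamma_nat_eq_factorial, Real.Gamma_add_one hNpos.ne']
  rw [show (1 - α) * (N : ℝ) + α * (N + 1) = N + α by ring, Real.Gamma_add_one hNpos.ne',
    Real.mul_rpow hNpos.le hG.le] at h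
  have hGp : Real.Gamma N ^ (1 - α) * Real.Gamma N ^ α = Real.Gamma N := by
    rw [← Real.rpow_add hG]; simp
  have hNp : (N : ℝ) ^ (1 - α) * (N : ℝ) ^ α = N := by
    rw [← Real.rpow_add hNpos]; simp
  have hpos : 0 < (N : ℝ) ^ (1 - α) := Real.rpow_pos_of_pos hNpos _
  rw [hf, div_le_div_iff₀ (by positivity) hpos]
  calc Real.Gamma (N + α) * (N : ℝ) ^ (1 - α)
      ≤ (Real.Gamma N ^ (1 - α) * ((N : ℝ) ^ α * Real.Gamma N ^ α)) * (N : ℝ) ^ (1 - α) := by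
        gcongr
    _ = ((N : ℝ) ^ (1 - α) * (N : ℝ) ^ α) * (Real.Gamma N ^ (1 - α) * Real.Gamma N ^ α) := by ring
    _ = 1 * (N * Real.Gamma N) := by rw [hGp, hNp, one_mul]

lemma abs_binomial_coeff_eq_sub {α : ℝ} (hα0 : 0 < α) (hα1 : α < 1) (n : ℕ) :
    |Real.Gamma (n + α) / (Real.Gamma (α - 1) * ((n + 1)! : ℝ))| =
      (Real.Gamma (n + α) / (n ! : ℝ) -
        Real.Gamma ((n + 1 : ℕ) + α) / ((n + 1)! : ℝ)) / Real.Gamma α := by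
  have hG : 0 < Real.Gamma α := Real.Gamma_pos_of_pos hα0
  have hn : 0 < n + α := by positivity
  have hGn : 0 < Real.Gamma (n + α) := Real.Gamma_pos_of_pos hn
  have h1 : Real.Gamma α = (α - 1) * Real.Gamma (α - 1) := by
    rw [← Real.Gamma_add_one (by linarith), sub_add_cancel]
  have h2 : Real.Gamma (α - 1) = -(Real.Gamma α / (1 - α)) := by
    have : (1 - α) ≠ 0 := by linarith
    field_simp
    linear_combination h1
  have h3 : Real.Gamma ((n + 1 : ℕ) + α) = (n + α) * Real.Gamma (n + α) := by
    rw [← Real.Gamma_add_one hn.ne']; push_cast; ring_nf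
  have hα : 0 < 1 - α := by linarith
  have hfac : (0 : ℝ) < (n ! : ℝ) := by positivity
  rw [h2, h3, Nat.factorial_succ, neg_mul, div_neg, abs_neg, abs_of_pos (by positivity)]
  push_cast
  field_simp
  ring

/-- The binomial remainder is bounded, uniformly on `[0, 1]`, by the telescoped sum of the
absolute values of its coefficients. -/
lemma abs_binomial_remainder_le {α : ℝ} (hα0 : 0 < α) (hα1 : α < 1) (N : ℕ) {u : ℝ}
    (hu0 : 0 ≤ u) (hu1 : u ≤ 1) :
    |∑' q : ℕ, Real.Gamma (((N : ℝ) + 1 + (q : ℝ)) - 1 + α) /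
        (Real.Gamma (α - 1) * ((N + 1 + q)! : ℝ)) * u ^ (N + 1 + q)| ≤
      Real.Gamma (N + α) / (N ! : ℝ) / Real.Gamma α := by
  have hG : 0 < Real.Gamma α := Real.Gamma_pos_of_pos hα0
  set g : ℕ → ℝ := fun n => Real.Gamma (n + α) / (n ! : ℝ)
  set F : ℕ → ℝ := fun q => Real.Gamma (((N : ℝ) + 1 + (q : ℝ)) - 1 + α) /
        (Real.Gamma (α - 1) * ((N + 1 + q)! : ℝ)) * u ^ (N + 1 + q) with hF
  have hterm (q : ℕ) : ‖F q‖ ≤ (g (N + q) - g (N + (q + 1))) / Real.Gamma α := by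
    have h := abs_binomial_coeff_eq_sub hα0 hα1 (N + q)
    have e : ((N : ℝ) + 1 + (q : ℝ)) - 1 + α = ((N + q : ℕ) : ℝ) + α := by push_cast; ring
    simp only [hF, Real.norm_eq_abs, abs_mul]
    rw [e, show N + 1 + q = N + q + 1 by ring, h, abs_of_nonneg (pow_nonneg hu0 _)]
    exact mul_le_of_le_one_right (h ▸ abs_nonneg _) (pow_le_one₀ hu0 hu1)
  have hsum (n : ℕ) : ∑ q ∈ Finset.range n, ‖F q‖ ≤ g N / Real.Gamma α := by
    refine (Finset.sum_le_sum fun q _ => hterm q).trans ?_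
    rw [← Finset.sum_div, Finset.sum_range_sub' (fun q => g (N + q))]
    have : 0 ≤ g (N + n) :=
      div_nonneg (Real.Gamma_pos_of_pos (by positivity)).le (by positivity)
    gcongr
    simpa using this
  exact (norm_tsum_le_tsum_norm (summable_of_sum_range_le (fun _ => norm_nonneg _) hsum)).trans
    (Real.tsum_le_of_sum_range_le (fun _ => norm_nonneg _) hsum)

/-- Truncation error bound for the moment expansion (case `n = 2`) of the
left Riemann–Liouville fractional derivative:
`|E_tr(t)| ≤ L₂ e^{(1-α)²+(1-α)} / (Γ(2-α)(1-α)N^{1-α}) (t-a)^{2-α}`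
where `E_tr(t) = ((t-a)^{1-α}/Γ(2-α)) ∫_a^t R_N(τ) ẍ(τ) dτ` and `R_N` is the
binomial remainder (reindexed by `q = p - (N+1) ∈ ℕ`). -/
theorem moment_expansion_truncation_error
    (a b α : ℝ) (hab : a < b) (hα0 : 0 < α) (hα1 : α < 1)
    (x x' x'' : ℝ → ℝ)
    (hx' : ∀ s ∈ Set.Icc a b, HasDerivWithinAt x (x' s) (Set.Icc a b) s)
    (hx'' : ∀ s ∈ Set.Icc a b, HasDerivWithinAt x' (x'' s) (Set.Icc a b) s)
    (hx''cont : ContinuousOn x'' (Set.Icc a b))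
    (N : ℕ) (hN : 1 ≤ N)
    (t : ℝ) (ht : t ∈ Set.Ioo a b)
    (L : ℝ) (hL : IsGreatest ((fun τ => |x'' τ|) '' Set.Icc a t) L) :
    |(t - a) ^ (1 - α) / Real.Gamma (2 - α) *
        ∫ τ in a..t,
          (∑' q : ℕ,
              Real.Gamma (((N : ℝ) + 1 + (q : ℝ)) - 1 + α) /
                  (Real.Gamma (α - 1) * ((N + 1 + q)! : ℝ)) *
                ((τ - a) / (t - a)) ^ (N + 1 + q)) * x'' τ| ≤
      L * Real.exp ((1 - α) ^ 2 + (1 - α)) /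
          (Real.Gamma (2 - α) * (1 - α) * (N : ℝ) ^ (1 - α)) *
        (t - a) ^ (2 - α) := by
  obtain ⟨hat, -⟩ := ht
  have hd : 0 < t - a := sub_pos.2 hat
  have hα : 0 < 1 - α := by linarith
  have hG2 : 0 < Real.Gamma (2 - α) := Real.Gamma_pos_of_pos (by linarith)
  have hNp : 0 < (N : ℝ) ^ (1 - α) := Real.rpow_pos_of_pos (by exact_mod_cast hN) _
  have hL0 : 0 ≤ L := by
    obtain ⟨s, -, rfl⟩ := hL.1
    exact abs_nonneg _
  have hcoef : Real.Gamma (N + α) / (N ! : ℝ) / Real.Gamma α ≤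
      Real.exp ((1 - α) ^ 2 + (1 - α)) / ((1 - α) * (N : ℝ) ^ (1 - α)) := by
    calc Real.Gamma (N + α) / (N ! : ℝ) / Real.Gamma α
        ≤ Real.Gamma (N + α) / (N ! : ℝ) :=
          div_le_self (div_nonneg (Real.Gamma_pos_of_pos (by positivity)).le (by positivity))
            (one_le_Gamma_of_le_one hα0 hα1.le)
      _ ≤ 1 / (N : ℝ) ^ (1 - α) := Gamma_nat_add_div_factorial_le hα0 hα1 hN
      _ ≤ Real.exp ((1 - α) ^ 2 + (1 - α)) / ((1 - α) * (N : ℝ) ^ (1 - α)) := by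
          gcongr
          · exact Real.one_le_exp (by positivity)
          · exact mul_le_of_le_one_left hNp.le (by linarith)
  have hint := intervalIntegral.norm_integral_le_of_norm_le_const (a := a) (b := t)
    (f := fun τ => (∑' q : ℕ, Real.Gamma (((N : ℝ) + 1 + (q : ℝ)) - 1 + α) /
      (Real.Gamma (α - 1) * ((N + 1 + q)! : ℝ)) * ((τ - a) / (t - a)) ^ (N + 1 + q)) * x'' τ)
    (C := Real.exp ((1 - α) ^ 2 + (1 - α)) / ((1 - α) * (N : ℝ) ^ (1 - α)) * L) (by
      intro τ hτ
      rw [Set.uIoc_of_le hat.le] at hτ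
      rw [norm_mul]
      refine mul_le_mul ((abs_binomial_remainder_le hα0 hα1 N
        (div_nonneg (by linarith [hτ.1]) hd.le) ((div_le_one hd).2 (by linarith [hτ.2]))).trans
        hcoef) (hL.2 ⟨τ, ⟨hτ.1.le, hτ.2⟩, rfl⟩) (norm_nonneg _) (by positivity))
  rw [Real.norm_eq_abs, abs_of_pos hd] at hint
  rw [abs_mul, abs_of_pos (by positivity : 0 < (t - a) ^ (1 - α) / Real.Gamma (2 - α))]
  refine (mul_le_mul_of_nonneg_left hint (by positivity)).trans_eq ?_
  rw [show 2 - α = (1 - α) + 1 by ring, Real.rpow_add_one hd.ne']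
  field_simp
end

section
/- Fix n ∈ ℕ, n ≥ 2, let 0 < α < 1, let x be n-times continuously differentiable on [a,b], and let N ≥ n be an integer. For t ∈ (a,b) define the truncation error E_tr(t) = ((t−a)^{n−1−α}/Γ(n−α)) ∫_a^t R_N(τ) x^{(n)}(τ) dτ, where R_N(τ) = Σ_{p=N+1}^∞ (Γ(p−n+1+α)/(Γ(α−n+1) p!)) ((τ−a)/(t−a))^p is the remainder of the binomial expansion of (1 − (τ−a)/(t−a))^{n−1−α}. Then |E_tr(t)| ≤ L_n · e^{(n−1−α)² + (n−1−α)} / (Γ(n−α)(n−1−α) N^{n−1−α}) · (t−a)^{n−α}, where L_n = max_{τ∈[a,t]} |x^{(n)}(τ)|. -/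
open MeasureTheory Real Nat

theorem abs_Gamma_succ_sub_le (m : ℕ) (β : ℝ) (h0 : 0 < β) (h1 : (m : ℝ) < β)
    (h2 : β < m + 1) :
    |Real.Gamma (m + 1 - β)| ≤ m ! * (β * |Real.Gamma (-β)|) := by
  induction m generalizing β with
  | zero =>
    have h := Real.Gamma_add_one (s := -β) (by linarith)
    rw [show ((0 : ℕ) : ℝ) + 1 - β = -β + 1 by push_cast; ring, h, abs_mul, abs_neg,
      abs_of_pos h0]
    simp
  | succ m ih =>
    push_cast at h1 h2 ⊢
    have hm : (0 : ℝ) ≤ m := m.cast_nonneg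
    have h := ih (β - 1) (by linarith) (by linarith) (by linarith)
    have hG := Real.Gamma_add_one (s := -β) (by linarith)
    rw [show (m : ℝ) + 1 - (β - 1) = m + 1 + 1 - β by ring,
      show -(β - 1) = -β + 1 by ring, hG, abs_mul, abs_neg, abs_of_pos h0] at h
    refine h.trans ?_
    rw [Nat.factorial_succ]
    push_cast
    have hnn : 0 ≤ (m ! : ℝ) * (β * |Real.Gamma (-β)|) := by positivity
    nlinarith

theorem Gamma_succ_sub_le_exp_harmonic (m : ℕ) (β : ℝ) (h0 : 0 < β) (h1 : (m : ℝ) < β)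
    (h2 : β < m + 1) (N : ℕ) (hN : m ≤ N) :
    Real.Gamma (N + 1 - β) ≤
      N ! * (β * |Real.Gamma (-β)|) * Real.exp (-β * ((harmonic N : ℝ) - harmonic m)) := by
  induction N, hN using Nat.le_induction with
  | base => simpa using (le_abs_self _).trans (abs_Gamma_succ_sub_le m β h0 h1 h2)
  | succ N hN ih =>
    have hmN : (m : ℝ) ≤ N := by exact_mod_cast hN
    have hpos : 0 < (N : ℝ) + 1 - β := by linarith
    have hN1 : (0 : ℝ) < N + 1 := by positivity
    have hexp : (N : ℝ) + 1 - β ≤ (N + 1) * Real.exp (-β * ((N : ℝ) + 1)⁻¹) := by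
      have h := Real.add_one_le_exp (-β * ((N : ℝ) + 1)⁻¹)
      calc (N : ℝ) + 1 - β = (N + 1) * (-β * ((N : ℝ) + 1)⁻¹ + 1) := by field_simp; ring
        _ ≤ _ := by gcongr
    rw [harmonic_succ, Nat.factorial_succ]
    push_cast
    rw [show (N : ℝ) + 1 + 1 - β = (N + 1 - β) + 1 by ring, Real.Gamma_add_one hpos.ne',
      show -β * ((harmonic N : ℝ) + ((N : ℝ) + 1)⁻¹ - harmonic m) =
        -β * ((N : ℝ) + 1)⁻¹ + -β * ((harmonic N : ℝ) - harmonic m) by ring, Real.exp_add]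
    calc _ ≤ ((N + 1) * Real.exp (-β * ((N : ℝ) + 1)⁻¹)) * _ :=
          mul_le_mul hexp ih (Real.Gamma_pos_of_pos hpos).le (by positivity)
      _ = _ := by ring

theorem Gamma_succ_sub_le_rpow (m : ℕ) (β : ℝ) (h0 : 0 < β) (h1 : (m : ℝ) < β)
    (h2 : β < m + 1) (N : ℕ) (hN : m ≤ N) (hN0 : 0 < N) :
    Real.Gamma (N + 1 - β) ≤
      N ! * (β * |Real.Gamma (-β)|) * (Real.exp (β ^ 2) / (N : ℝ) ^ β) := by
  refine (Gamma_succ_sub_le_exp_harmonic m β h0 h1 h2 N hN).trans ?_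
  have hNpos : (0 : ℝ) < N := by exact_mod_cast hN0
  have hlog : Real.log N ≤ harmonic N :=
    (Real.log_le_log hNpos (by push_cast; linarith)).trans (log_add_one_le_harmonic N)
  have hm : (harmonic m : ℝ) ≤ m := by
    have h : harmonic m ≤ m := by
      rw [harmonic]
      refine (Finset.sum_le_card_nsmul _ _ 1 fun i _ => ?_).trans (by simp)
      exact inv_le_one_of_one_le₀ (by push_cast; linarith [(Nat.cast_nonneg i : (0 : ℚ) ≤ i)])
    exact_mod_cast h
  rw [Real.rpow_def_of_pos hNpos, ← Real.exp_sub]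
  gcongr
  nlinarith

theorem sum_range_Gamma_sub_div_factorial_le (β : ℝ) (h0 : 0 < β) (N : ℕ) (hN : β < N + 1)
    (k : ℕ) :
    ∑ q ∈ Finset.range k, Real.Gamma (N + 1 + q - β) / ((N + 1 + q)! : ℝ) ≤
      Real.Gamma (N + 1 - β) / (N ! * β) := by
  have key : ∑ q ∈ Finset.range k, Real.Gamma (N + 1 + q - β) / ((N + 1 + q)! : ℝ) =
      Real.Gamma (N + 1 - β) / (N ! * β) - Real.Gamma (N + 1 + k - β) / ((N + k)! * β) := by
    induction k with
    | zero => simp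
    | succ k ih =>
      have hpos : 0 < (N : ℝ) + 1 + k - β := by
        linarith [(Nat.cast_nonneg k : (0 : ℝ) ≤ k)]
      rw [Finset.sum_range_succ, ih, show N + (k + 1) = N + k + 1 by ring,
        show N + 1 + k = N + k + 1 by ring, Nat.factorial_succ]
      push_cast
      rw [show (N : ℝ) + 1 + (k + 1) - β = (N + 1 + k - β) + 1 by ring,
        Real.Gamma_add_one hpos.ne']
      field_simp
      ring
  have hpos : 0 < (N : ℝ) + 1 + k - β := by
    linarith [(Nat.cast_nonneg k : (0 : ℝ) ≤ k)]
  have := Real.Gamma_pos_of_pos hpos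
  have : 0 ≤ Real.Gamma (N + 1 + k - β) / ((N + k)! * β) := by positivity
  linarith

theorem abs_tsum_binomial_remainder_le (m : ℕ) (β : ℝ) (h0 : 0 < β) (h1 : (m : ℝ) < β)
    (h2 : β < m + 1) (N : ℕ) (hN : m ≤ N) (hN0 : 0 < N) (s : ℝ) (hs0 : 0 ≤ s) (hs1 : s ≤ 1) :
    |∑' q : ℕ, Real.Gamma (N + 1 + q - β) / (Real.Gamma (-β) * ((N + 1 + q)! : ℝ)) *
      s ^ (N + 1 + q)| ≤ Real.exp (β ^ 2) / (N : ℝ) ^ β := by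
  have hmN : (m : ℝ) ≤ N := by exact_mod_cast hN
  have hG : 0 < |Real.Gamma (-β)| := by
    refine abs_pos.mpr (Real.Gamma_ne_zero fun k hk => ?_)
    have hk' : β = k := by linarith
    rw [hk'] at h1 h2
    norm_cast at h1 h2
    omega
  have hΓ (q : ℕ) : 0 < Real.Gamma (N + 1 + q - β) :=
    Real.Gamma_pos_of_pos (by linarith [(Nat.cast_nonneg q : (0 : ℝ) ≤ q)])
  have hnn (q : ℕ) : 0 ≤ Real.Gamma (N + 1 + q - β) / ((N + 1 + q)! : ℝ) := by
    have := hΓ q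
    positivity
  have hsum := sum_range_Gamma_sub_div_factorial_le β h0 N (by linarith)
  have hS := summable_of_sum_range_le hnn hsum
  have hb := tsum_of_norm_bounded (hS.hasSum.div_const |Real.Gamma (-β)|)
    (f := fun q : ℕ => Real.Gamma (N + 1 + q - β) / (Real.Gamma (-β) * ((N + 1 + q)! : ℝ)) *
      s ^ (N + 1 + q)) fun q => by
    rw [Real.norm_eq_abs, abs_mul, abs_div, abs_mul, abs_of_pos (hΓ q),
      abs_of_nonneg (pow_nonneg hs0 _), Nat.abs_cast, div_div, mul_comm |Real.Gamma (-β)|]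
    have := hΓ q
    exact mul_le_of_le_one_right (by positivity) (pow_le_one₀ hs0 hs1)
  refine hb.trans ?_
  rw [div_le_iff₀ hG]
  refine (Real.tsum_le_of_sum_range_le hnn hsum).trans ?_
  rw [div_le_iff₀ (by positivity)]
  refine (Gamma_succ_sub_le_rpow m β h0 h1 h2 N hN hN0).trans_eq ?_
  ring

/-- Truncation error bound for the generalized moment expansion of order `n`
of the left Riemann–Liouville fractional derivative:
`|E_tr(t)| ≤ L_n e^{(n-1-α)²+(n-1-α)} / (Γ(n-α)(n-1-α)N^{n-1-α}) (t-a)^{n-α}`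
where `E_tr(t) = ((t-a)^{n-1-α}/Γ(n-α)) ∫_a^t R_N(τ) x^{(n)}(τ) dτ` and `R_N`
is the binomial remainder (reindexed by `q = p - (N+1) ∈ ℕ`). -/
theorem generalized_moment_expansion_truncation_error
    (n : ℕ) (hn : 2 ≤ n) (a b α : ℝ) (hab : a < b) (hα0 : 0 < α) (hα1 : α < 1)
    (x : ℝ → ℝ) (hx : ContDiffOn ℝ n x (Set.Icc a b))
    (N : ℕ) (hN : n ≤ N)
    (t : ℝ) (ht : t ∈ Set.Ioo a b)
    (L : ℝ)
    (hL : IsGreatest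
      ((fun τ => |iteratedDerivWithin n x (Set.Icc a b) τ|) '' Set.Icc a t) L) :
    |(t - a) ^ ((n : ℝ) - 1 - α) / Real.Gamma ((n : ℝ) - α) *
        ∫ τ in a..t,
          (∑' q : ℕ,
              Real.Gamma (((N : ℝ) + 1 + (q : ℝ)) - (n : ℝ) + 1 + α) /
                  (Real.Gamma (α - (n : ℝ) + 1) * ((N + 1 + q)! : ℝ)) *
                ((τ - a) / (t - a)) ^ (N + 1 + q)) *
            iteratedDerivWithin n x (Set.Icc a b) τ| ≤
      L * Real.exp (((n : ℝ) - 1 - α) ^ 2 + ((n : ℝ) - 1 - α)) /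
          (Real.Gamma ((n : ℝ) - α) * ((n : ℝ) - 1 - α) *
            (N : ℝ) ^ ((n : ℝ) - 1 - α)) *
        (t - a) ^ ((n : ℝ) - α) := by
  obtain ⟨m, rfl⟩ : ∃ m, n = m + 2 := ⟨n - 2, by omega⟩
  obtain ⟨hat, htb⟩ := ht
  have hta : 0 < t - a := sub_pos.mpr hat
  set β : ℝ := ((m + 2 : ℕ) : ℝ) - 1 - α with hβ
  have hβ' : β = m + 1 - α := by rw [hβ]; push_cast; ring
  have hm : (0 : ℝ) ≤ m := m.cast_nonneg
  have h0 : 0 < β := by linarith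
  have hN0 : (0 : ℝ) < N := by exact_mod_cast (by omega : 0 < N)
  have hL0 : 0 ≤ L := by
    obtain ⟨τ, -, rfl⟩ := hL.1
    exact abs_nonneg _
  have hG : 0 < Real.Gamma (((m + 2 : ℕ) : ℝ) - α) :=
    Real.Gamma_pos_of_pos (by linarith)
  have hint := intervalIntegral.norm_integral_le_of_norm_le_const (a := a) (b := t)
    (C := Real.exp (β ^ 2) / (N : ℝ) ^ β * L)
    (f := fun τ => (∑' q : ℕ,
              Real.Gamma (((N : ℝ) + 1 + (q : ℝ)) - ((m + 2 : ℕ) : ℝ) + 1 + α) /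
                  (Real.Gamma (α - ((m + 2 : ℕ) : ℝ) + 1) * ((N + 1 + q)! : ℝ)) *
                ((τ - a) / (t - a)) ^ (N + 1 + q)) *
            iteratedDerivWithin (m + 2) x (Set.Icc a b) τ) fun τ hτ => by
    rw [Set.uIoc_of_le hat.le] at hτ
    rw [norm_mul]
    refine mul_le_mul ?_ (hL.2 ⟨τ, ⟨hτ.1.le, hτ.2⟩, rfl⟩) (norm_nonneg _) (by positivity)
    rw [show α - ((m + 2 : ℕ) : ℝ) + 1 = -β by rw [hβ]; ring]
    simp_rw [show ∀ q : ℕ, (N : ℝ) + 1 + q - ((m + 2 : ℕ) : ℝ) + 1 + α = N + 1 + q - β from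
      fun q => by rw [hβ]; ring]
    exact abs_tsum_binomial_remainder_le m β h0 (by linarith) (by linarith) N (by omega)
      (by omega) _ (div_nonneg (by linarith [hτ.1]) hta.le)
      ((div_le_one hta).mpr (by linarith [hτ.2]))
  rw [Real.norm_eq_abs, abs_of_pos hta] at hint
  rw [abs_mul, abs_of_pos (by positivity)]
  refine (mul_le_mul_of_nonneg_left hint (by positivity)).trans ?_
  rw [show ((m + 2 : ℕ) : ℝ) - α = β + 1 by rw [hβ]; ring] at hG ⊢
  rw [Real.rpow_add_one hta.ne', Real.exp_add]
  have hexp : 1 ≤ Real.exp β / β := by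
    rw [one_le_div h0]
    linarith [Real.add_one_le_exp β]
  calc _ = L * Real.exp (β ^ 2) / (Real.Gamma (β + 1) * (N : ℝ) ^ β) *
          ((t - a) ^ β * (t - a)) * 1 := by field_simp
    _ ≤ L * Real.exp (β ^ 2) / (Real.Gamma (β + 1) * (N : ℝ) ^ β) *
          ((t - a) ^ β * (t - a)) * (Real.exp β / β) := by gcongr
    _ = _ := by field_simp
end

section
/- Fix n ∈ ℕ, n ≥ 1, let 0 < α < 1 and let x be n-times continuously differentiable on [a,b]. Then for every t ∈ (a,b), ₐD_t^α x(t) = Σ_{k=0}^{n−1} (x^{(k)}(a)/Γ(k+1−α)) (t−a)^{k−α} + (1/Γ(n−α)) ∫_a^t (t−τ)^{n−1−α} x^{(n)}(τ) dτ. -/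
open MeasureTheory Real

lemma intervalIntegrable_sub_rpow {r : ℝ} (hr : -1 < r) (a t : ℝ) :
    IntervalIntegrable (fun τ => (t - τ) ^ r) volume a t := by
  simpa using (intervalIntegral.intervalIntegrable_rpow' (a := t - a) (b := t - t) hr).comp_sub_left t

/-- Integration by parts against the Riemann–Liouville kernel. -/
lemma mul_integral_sub_rpow_mul {p a t : ℝ} (hp : 0 < p) (hat : a ≤ t) {f f' : ℝ → ℝ}
    (hf : ContinuousOn f (Set.Icc a t)) (hf' : ContinuousOn f' (Set.Icc a t))
    (hd : ∀ τ ∈ Set.Ioo a t, HasDerivAt f (f' τ) τ) :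
    p * ∫ τ in a..t, (t - τ) ^ (p - 1) * f τ =
      f a * (t - a) ^ p + ∫ τ in a..t, (t - τ) ^ p * f' τ := by
  have hv : ContinuousOn (fun τ => -(t - τ) ^ p) (Set.uIcc a t) :=
    (((continuous_const.sub continuous_id).rpow_const fun _ => Or.inr hp.le).neg).continuousOn
  have key := intervalIntegral.integral_mul_deriv_eq_deriv_mul_of_hasDerivAt
    (u := f) (u' := f') (v := fun τ => -(t - τ) ^ p) (v' := fun τ => p * (t - τ) ^ (p - 1))
    (by rwa [Set.uIcc_of_le hat]) hv
    (by rwa [min_eq_left hat, max_eq_right hat])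
    (by
      rw [min_eq_left hat, max_eq_right hat]
      intro τ hτ
      have h := (((hasDerivAt_id τ).const_sub t).rpow_const (p := p)
        (Or.inl (sub_pos.2 hτ.2).ne')).neg
      exact h.congr_deriv (by simp))
    (ContinuousOn.intervalIntegrable (by rwa [Set.uIcc_of_le hat]))
    ((intervalIntegrable_sub_rpow (by linarith) a t).const_mul p)
  rw [← intervalIntegral.integral_const_mul]
  calc ∫ τ in a..t, p * ((t - τ) ^ (p - 1) * f τ)
      = ∫ τ in a..t, f τ * (p * (t - τ) ^ (p - 1)) := by
        congr 1; ext τ; ring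
    _ = _ := key
    _ = _ := by
        have h : (fun τ => f' τ * -(t - τ) ^ p) = fun τ => -((t - τ) ^ p * f' τ) := by
          ext τ; ring
        rw [h, intervalIntegral.integral_neg, sub_self, zero_rpow hp.ne']
        ring

/-- Rescaling a Riemann–Liouville integral to the unit interval. -/
lemma integral_sub_rpow_mul_eq_rescaled {a s : ℝ} (has : a < s) (r : ℝ) (g : ℝ → ℝ) :
    ∫ τ in a..s, (s - τ) ^ r * g τ =
      (s - a) ^ (r + 1) * ∫ v in (0 : ℝ)..1, (1 - v) ^ r * g (a + (s - a) * v) := by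
  have hs : 0 < s - a := sub_pos.2 has
  have h := intervalIntegral.mul_integral_comp_add_mul (a := 0) (b := 1)
    (f := fun τ => (s - τ) ^ r * g τ) (s - a) a
  rw [show a + (s - a) * 0 = a by ring, show a + (s - a) * 1 = s by ring] at h
  rw [← h, rpow_add hs, rpow_one, mul_comm ((s - a) ^ r), mul_assoc,
    ← intervalIntegral.integral_const_mul ((s - a) ^ r)]
  congr 1
  refine intervalIntegral.integral_congr fun v hv => ?_
  rw [Set.uIcc_of_le zero_le_one] at hv
  rw [show s - (a + (s - a) * v) = (s - a) * (1 - v) by ring,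
    mul_rpow hs.le (sub_nonneg.2 hv.2), mul_assoc]

/-- Differentiation of the Riemann–Liouville integral of a continuously differentiable function. -/
lemma hasDerivAt_integral_sub_rpow_neg_mul {a b α t : ℝ} (hα1 : α < 1) (ht : t ∈ Set.Ioo a b)
    {f f' : ℝ → ℝ} (hf : ContinuousOn f (Set.Icc a b)) (hf' : ContinuousOn f' (Set.Icc a b))
    (hd : ∀ τ ∈ Set.Ioo a b, HasDerivAt f (f' τ) τ) :
    HasDerivAt (fun s => ∫ τ in a..s, (s - τ) ^ (-α) * f τ)
      (f a * (t - a) ^ (-α) + ∫ τ in a..t, (t - τ) ^ (-α) * f' τ) t := by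
  have hc : 0 < t - a := sub_pos.2 ht.1
  have hmaps : ∀ s ∈ Set.Ioo a b, Set.MapsTo (fun v => a + (s - a) * v)
      (Set.uIcc (0 : ℝ) 1) (Set.Icc a b) := by
    intro s hs v hv
    rw [Set.uIcc_of_le zero_le_one] at hv
    have h1 := mul_nonneg (sub_nonneg.2 hs.1.le) hv.1
    have h2 := mul_le_mul_of_nonneg_left hv.2 (sub_nonneg.2 hs.1.le)
    exact ⟨by linarith, by linarith [hs.2]⟩
  have hcomp : ∀ g : ℝ → ℝ, ContinuousOn g (Set.Icc a b) → ∀ s ∈ Set.Ioo a b,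
      ContinuousOn (fun v => g (a + (s - a) * v)) (Set.uIcc (0 : ℝ) 1) := fun g hg s hs =>
    hg.comp (by fun_prop) (hmaps s hs)
  have hker := intervalIntegrable_sub_rpow (r := -α) (by linarith) 0 1
  obtain ⟨C, hC⟩ := isCompact_Icc.exists_bound_of_continuousOn hf'
  have hcf'v : ContinuousOn (fun v => v * f' (a + (t - a) * v)) (Set.uIcc (0 : ℝ) 1) :=
    continuousOn_id.mul (hcomp f' hf' t ht)
  have hnhds : Set.Ioo a b ∈ nhds t := Ioo_mem_nhds ht.1 ht.2
  have hne : ∀ᵐ v : ℝ ∂volume, v ≠ 1 := by simp [ae_iff]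
  have hJ := (intervalIntegral.hasDerivAt_integral_of_dominated_loc_of_deriv_le (μ := volume)
    (F := fun s v => (1 - v) ^ (-α) * f (a + (s - a) * v))
    (F' := fun s v => (1 - v) ^ (-α) * (v * f' (a + (s - a) * v)))
    (bound := fun v => (1 - v) ^ (-α) * C) (a := 0) (b := 1) hnhds
    (by
      filter_upwards [hnhds] with s hs
      exact (hker.mul_continuousOn (hcomp f hf s hs)).def'.aestronglyMeasurable)
    (hker.mul_continuousOn (hcomp f hf t ht))
    (hker.mul_continuousOn hcf'v).def'.aestronglyMeasurable
    (by
      refine Filter.Eventually.of_forall fun v hv s hs => ?_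
      have hm := hC _ (hmaps s hs (Set.uIoc_subset_uIcc hv))
      rw [Set.uIoc_of_le zero_le_one] at hv
      have hk : 0 ≤ (1 - v) ^ (-α) := rpow_nonneg (sub_nonneg.2 hv.2) _
      rw [norm_mul, norm_mul, norm_of_nonneg hk, norm_of_nonneg hv.1.le]
      refine mul_le_mul_of_nonneg_left ?_ hk
      exact (mul_le_of_le_one_left (norm_nonneg _) hv.2).trans hm)
    (hker.mul_const C)
    (by
      filter_upwards [hne] with v hv1 hv s hs
      rw [Set.uIoc_of_le zero_le_one] at hv
      have hs0 : 0 < s - a := sub_pos.2 hs.1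
      have hlt : v < 1 := lt_of_le_of_ne hv.2 hv1
      have hmem : a + (s - a) * v ∈ Set.Ioo a b :=
        ⟨by linarith [mul_pos hs0 hv.1], by
          linarith [mul_lt_mul_of_pos_left hlt hs0, hs.2]⟩
      have hin : HasDerivAt (fun s => a + (s - a) * v) v s := by
        simpa using (((hasDerivAt_id s).sub_const a).mul_const v).const_add a
      have h := ((hd _ hmem).comp s hin).const_mul ((1 - v) ^ (-α))
      rwa [mul_comm (f' _)] at h)).2
  have hpow : HasDerivAt (fun s => (s - a) ^ (-α + 1)) ((-α + 1) * (t - a) ^ (-α)) t := by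
    simpa using ((hasDerivAt_id t).sub_const a).rpow_const (p := -α + 1) (Or.inl hc.ne')
  have hmain := (hpow.mul hJ).congr_of_eventuallyEq
    (f₁ := fun s => ∫ τ in a..s, (s - τ) ^ (-α) * f τ) (by
      filter_upwards [hnhds] with s hs
      exact integral_sub_rpow_mul_eq_rescaled hs.1 (-α) f)
  refine hmain.congr_deriv ?_
  have hsub : Set.Icc a t ⊆ Set.Icc a b := Set.Icc_subset_Icc_right ht.2.le
  have hibp := mul_integral_sub_rpow_mul (p := -α + 1) (by linarith) ht.1.le
    (hf.mono hsub) (hf'.mono hsub) fun τ hτ => hd τ ⟨hτ.1, hτ.2.trans ht.2⟩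
  rw [add_sub_cancel_right, integral_sub_rpow_mul_eq_rescaled ht.1,
    integral_sub_rpow_mul_eq_rescaled ht.1] at hibp
  rw [integral_sub_rpow_mul_eq_rescaled ht.1 (-α) f']
  have hsplit : ∫ v in (0 : ℝ)..1, (1 - v) ^ (-α) * f' (a + (t - a) * v) =
      (∫ v in (0 : ℝ)..1, (1 - v) ^ (-α + 1) * f' (a + (t - a) * v)) +
        ∫ v in (0 : ℝ)..1, (1 - v) ^ (-α) * (v * f' (a + (t - a) * v)) := by
    rw [← intervalIntegral.integral_add
      ((intervalIntegrable_sub_rpow (by linarith) 0 1).mul_continuousOn (hcomp f' hf' t ht))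
      (hker.mul_continuousOn hcf'v)]
    refine intervalIntegral.integral_congr_ae ?_
    filter_upwards [hne] with v hv1 hv
    rw [Set.uIoc_of_le zero_le_one] at hv
    rw [rpow_add (sub_pos.2 (lt_of_le_of_ne hv.2 hv1)), rpow_one]
    ring
  rw [hsplit]
  simp only [rpow_add hc, rpow_one] at hibp ⊢
  refine mul_left_cancel₀ hc.ne' ?_
  linear_combination hibp

/-- The `n`-fold integration-by-parts representation of the left
Riemann–Liouville fractional derivative of an `n`-times continuously
differentiable function:
`ₐD_t^α x(t) = Σ_{k=0}^{n-1} x^{(k)}(a)(t-a)^{k-α}/Γ(k+1-α)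
  + (1/Γ(n-α)) ∫_a^t (t-τ)^{n-1-α} x^{(n)}(τ) dτ`. -/
theorem rl_deriv_n_fold_integration_by_parts
    (n : ℕ) (hn : 1 ≤ n) (a b α : ℝ) (hab : a < b) (hα0 : 0 < α) (hα1 : α < 1)
    (x : ℝ → ℝ) (hx : ContDiffOn ℝ n x (Set.Icc a b))
    (t : ℝ) (ht : t ∈ Set.Ioo a b) :
    (Real.Gamma (1 - α))⁻¹ *
        deriv (fun s => ∫ τ in a..s, (s - τ) ^ (-α) * x τ) t =
      (∑ k ∈ Finset.range n,
        iteratedDerivWithin k x (Set.Icc a b) a / Real.Gamma ((k : ℝ) + 1 - α) *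
          (t - a) ^ ((k : ℝ) - α)) +
        (1 / Real.Gamma ((n : ℝ) - α)) *
          ∫ τ in a..t,
            (t - τ) ^ ((n : ℝ) - 1 - α) *
              iteratedDerivWithin n x (Set.Icc a b) τ := by
  have hu : UniqueDiffOn ℝ (Set.Icc a b) := uniqueDiffOn_Icc hab
  have hderiv : ∀ m k : ℕ, k < m → ContDiffOn ℝ m x (Set.Icc a b) → ∀ τ ∈ Set.Ioo a b,
      HasDerivAt (iteratedDerivWithin k x (Set.Icc a b))
        (iteratedDerivWithin (k + 1) x (Set.Icc a b) τ) τ := by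
    intro m k hk hm τ hτ
    rw [iteratedDerivWithin_succ]
    exact ((hm.differentiableOn_iteratedDerivWithin (by exact_mod_cast hk) hu τ
      (Set.Ioo_subset_Icc_self hτ)).hasDerivWithinAt).hasDerivAt (Icc_mem_nhds hτ.1 hτ.2)
  have hcont : ∀ m k : ℕ, k ≤ m → ContDiffOn ℝ m x (Set.Icc a b) →
      ContinuousOn (iteratedDerivWithin k x (Set.Icc a b)) (Set.Icc a b) := fun m k hk hm =>
    hm.continuousOn_iteratedDerivWithin (by exact_mod_cast hk) hu
  induction n, hn using Nat.le_induction with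
  | base =>
    have h := hasDerivAt_integral_sub_rpow_neg_mul hα1 ht (hcont 1 0 zero_le_one hx)
      (hcont 1 1 le_rfl hx) (hderiv 1 0 zero_lt_one hx)
    simp only [iteratedDerivWithin_zero] at h
    rw [h.deriv]
    simp only [Finset.sum_range_one, iteratedDerivWithin_zero, Nat.cast_zero, Nat.cast_one,
      zero_add, zero_sub, sub_self]
    ring
  | succ m hm ih =>
    have hm1 : (1 : ℝ) ≤ m := by exact_mod_cast hm
    have hp : 0 < (m : ℝ) - α := by linarith
    have hsub : Set.Icc a t ⊆ Set.Icc a b := Set.Icc_subset_Icc_right ht.2.le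
    have hibp := mul_integral_sub_rpow_mul hp ht.1.le
      ((hcont (m + 1) m m.le_succ hx).mono hsub) ((hcont (m + 1) (m + 1) le_rfl hx).mono hsub)
      fun τ hτ => hderiv (m + 1) m m.lt_succ_self hx τ ⟨hτ.1, hτ.2.trans ht.2⟩
    have hΓ : Real.Gamma ((m : ℝ) + 1 - α) = (m - α) * Real.Gamma (m - α) := by
      rw [← Real.Gamma_add_one hp.ne']
      congr 1
      ring
    have hΓpos := Real.Gamma_pos_of_pos hp
    rw [ih (hx.of_le (by exact_mod_cast m.le_succ)), Finset.sum_range_succ, add_assoc]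
    congr 1
    push_cast
    rw [hΓ, show (m : ℝ) + 1 - 1 - α = m - α by ring, show (m : ℝ) - 1 - α = m - α - 1 by ring]
    field_simp
    linear_combination hibp
end

section
/- Fix n ∈ ℕ, n ≥ 1, let 0 < α < 1, let x be n-times continuously differentiable on [a,b], and let t ∈ (a,b). Then ∫_a^t (t−τ)^{n−1−α} x^{(n)}(τ) dτ = (t−a)^{n−1−α} Σ_{p=0}^∞ (Γ(p−n+1+α)/(Γ(1−n+α) p! (t−a)^p)) ∫_a^t (τ−a)^p x^{(n)}(τ) dτ, where the series on the right-hand side converges. -/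
open MeasureTheory Real Nat

/-- The recurrence for multichoose coefficients over the reals. -/
theorem Real.succ_mul_multichoose_succ (r : ℝ) (p : ℕ) :
    ((p : ℝ) + 1) * Ring.multichoose r (p + 1) = (r + p) * Ring.multichoose r p := by
  have h (k : ℕ) : (k ! : ℝ) * Ring.multichoose r k = (ascPochhammer ℝ k).eval r := by
    rw [← nsmul_eq_mul, Ring.factorial_nsmul_multichoose_eq_ascPochhammer,
      Polynomial.ascPochhammer_smeval_eq_eval]
  have hp := h p
  have hp1 := h (p + 1)
  rw [ascPochhammer_succ_eval, ← hp, Nat.factorial_succ] at hp1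
  push_cast at hp1
  have h0 : (p ! : ℝ) ≠ 0 := by positivity
  apply mul_left_cancel₀ h0
  linear_combination hp1

theorem Real.Gamma_natCast_add_div (r : ℝ) (hr : ∀ m : ℕ, r ≠ -m) (p : ℕ) :
    Real.Gamma (p + r) / (Real.Gamma r * p !) = Ring.multichoose r p := by
  have hG : Real.Gamma r ≠ 0 := Real.Gamma_ne_zero hr
  induction p with
  | zero => simp [hG]
  | succ p ih =>
    have hp : (p : ℝ) + r ≠ 0 := fun h => hr p (by linarith)
    have hp1 : (p : ℝ) + 1 ≠ 0 := by positivity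
    have h0 : (p ! : ℝ) ≠ 0 := by positivity
    have hrec := Real.succ_mul_multichoose_succ r p
    rw [← ih] at hrec
    have hΓ : Real.Gamma ((p + 1 : ℕ) + r) = (p + r) * Real.Gamma (p + r) := by
      rw [← Real.Gamma_add_one hp]
      push_cast
      ring_nf
    apply mul_left_cancel₀ hp1
    rw [hrec, hΓ, Nat.factorial_succ]
    push_cast
    field_simp
    ring

/-- The binomial series of `(1 - u) ^ (-r)`. -/
theorem Real.hasSum_multichoose_mul_pow (r : ℝ) {u : ℝ} (hu : |u| < 1) :
    HasSum (fun p : ℕ => Ring.multichoose r p * u ^ p) ((1 - u) ^ (-r)) := by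
  have hmem : u ∈ Metric.eball (0 : ℝ) 1 := by
    rw [Metric.mem_eball, edist_zero_right, ← ofReal_norm, Real.norm_eq_abs]
    simpa using hu
  have h := (Real.one_div_one_sub_rpow_hasFPowerSeriesOnBall_zero r).hasSum hmem
  have h1 : 0 ≤ 1 - u := by linarith [(abs_lt.mp hu).2]
  simpa [Real.rpow_neg h1, FormalMultilinearSeries.ofScalars_apply_eq, Ring.multichoose_eq,
    mul_comm]
    using h

theorem Real.multichoose_pos {s : ℝ} (hs : 0 < s) (p : ℕ) : 0 < Ring.multichoose s p := by
  induction p with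
  | zero => simp
  | succ p ih =>
    have h := Real.succ_mul_multichoose_succ s p
    have : 0 < (s + p) * Ring.multichoose s p := by positivity
    rw [← h] at this
    exact pos_of_mul_pos_right this (by positivity)

theorem Real.exists_abs_multichoose_le {r s : ℝ} (hs : 0 < s) (hrs : r ≤ s) :
    ∃ C : ℝ, 0 ≤ C ∧ ∀ p : ℕ, |Ring.multichoose r p| ≤ C * Ring.multichoose s p := by
  obtain ⟨N, hN⟩ := exists_nat_ge (-r)
  have hnn (k : ℕ) : 0 ≤ |Ring.multichoose r k| / Ring.multichoose s k :=
    div_nonneg (abs_nonneg _) (Real.multichoose_pos hs k).le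
  refine ⟨∑ k ∈ Finset.range (N + 1), |Ring.multichoose r k| / Ring.multichoose s k,
    Finset.sum_nonneg fun k _ => hnn k, fun p => ?_⟩
  have hle (k : ℕ) (hk : k ≤ N) : |Ring.multichoose r k| ≤
      (∑ k ∈ Finset.range (N + 1), |Ring.multichoose r k| / Ring.multichoose s k) *
        Ring.multichoose s k := by
    rw [← div_le_iff₀ (Real.multichoose_pos hs k)]
    exact Finset.single_le_sum (f := fun k => |Ring.multichoose r k| / Ring.multichoose s k)
      (fun i _ => hnn i) (Finset.mem_range.mpr (by omega))
  rcases le_total p N with hp | hp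
  · exact hle p hp
  · induction p, hp using Nat.le_induction with
    | base => exact hle N le_rfl
    | succ p hp ih =>
      have hp' : (N : ℝ) ≤ p := by exact_mod_cast hp
      have h1 : (0 : ℝ) < p + 1 := by positivity
      have hr := congrArg abs (Real.succ_mul_multichoose_succ r p)
      rw [abs_mul, abs_mul, abs_of_pos h1, abs_of_nonneg (by linarith : 0 ≤ r + p)] at hr
      refine le_of_mul_le_mul_left ?_ h1
      rw [hr, mul_left_comm, Real.succ_mul_multichoose_succ s p, mul_left_comm]
      exact mul_le_mul (by linarith) ih (abs_nonneg _) (by positivity)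

/-- Termwise integration of the binomial series of `(t - τ) ^ (-r)` about `τ = a` against a
continuous function. -/
theorem intervalIntegral.hasSum_multichoose_integral {a t r s : ℝ} (hat : a < t) (hs : 0 < s)
    (hs1 : s < 1) (hrs : r ≤ s) {f : ℝ → ℝ} (hf : ContinuousOn f (Set.Icc a t)) :
    HasSum
      (fun p : ℕ => ∫ τ in a..t,
        (t - a) ^ (-r) * (Ring.multichoose r p * ((τ - a) / (t - a)) ^ p) * f τ)
      (∫ τ in a..t, (t - τ) ^ (-r) * f τ) := by
  obtain ⟨C, hC0, hC⟩ := Real.exists_abs_multichoose_le hs hrs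
  obtain ⟨M, hM⟩ := isCompact_Icc.exists_bound_of_continuousOn hf
  have hL : 0 < t - a := sub_pos.mpr hat
  have hne : ∀ᵐ τ ∂(volume : Measure ℝ), τ ≠ t := by
    simp [ae_iff]
  have hu {τ : ℝ} (hτ : τ ∈ Set.uIoc a t) (hτt : τ ≠ t) :
      0 ≤ (τ - a) / (t - a) ∧ |(τ - a) / (t - a)| < 1 := by
    rw [Set.uIoc_of_le hat.le] at hτ
    have h0 : 0 ≤ (τ - a) / (t - a) := div_nonneg (by linarith [hτ.1]) hL.le
    refine ⟨h0, ?_⟩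
    rw [abs_of_nonneg h0, div_lt_one hL]
    linarith [lt_of_le_of_ne hτ.2 hτt]
  have hpow {τ : ℝ} (q : ℝ) (hτ : τ ∈ Set.uIoc a t) :
      (t - a) ^ q * (1 - (τ - a) / (t - a)) ^ q = (t - τ) ^ q := by
    rw [Set.uIoc_of_le hat.le] at hτ
    have h : 1 - (τ - a) / (t - a) = (t - τ) / (t - a) := by
      field_simp
      ring
    rw [h, ← Real.mul_rpow hL.le (div_nonneg (by linarith [hτ.2]) hL.le),
      mul_div_cancel₀ _ hL.ne']
  have hbound {τ : ℝ} (hτ : τ ∈ Set.uIoc a t) (hτt : τ ≠ t) :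
      HasSum (fun p : ℕ => (t - a) ^ (-r) * M * C *
          (Ring.multichoose s p * ((τ - a) / (t - a)) ^ p))
        ((t - a) ^ (-r) * M * C * ((1 - (τ - a) / (t - a)) ^ (-s))) :=
    (Real.hasSum_multichoose_mul_pow s (hu hτ hτt).2).mul_left _
  refine intervalIntegral.hasSum_integral_of_dominated_convergence
    (fun p τ => (t - a) ^ (-r) * M * C * (Ring.multichoose s p * ((τ - a) / (t - a)) ^ p))
    (fun p => ?_) (fun p => ?_) ?_ ?_ ?_
  · rw [Set.uIoc_of_le hat.le]
    refine ContinuousOn.aestronglyMeasurable ?_ measurableSet_Ioc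
    exact ContinuousOn.mul (by fun_prop) (hf.mono Set.Ioc_subset_Icc_self)
  · filter_upwards [hne] with τ hτt hτ
    have h0 := (hu hτ hτt).1
    have hMτ : |f τ| ≤ M := by
      rw [Set.uIoc_of_le hat.le] at hτ
      exact hM τ (Set.Ioc_subset_Icc_self hτ)
    have hLr : 0 ≤ (t - a) ^ (-r) := Real.rpow_nonneg hL.le _
    rw [Real.norm_eq_abs, abs_mul, abs_mul, abs_mul, abs_of_nonneg hLr,
      abs_of_nonneg (pow_nonneg h0 p)]
    calc (t - a) ^ (-r) * (|Ring.multichoose r p| * ((τ - a) / (t - a)) ^ p) * |f τ|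
        ≤ (t - a) ^ (-r) * (C * Ring.multichoose s p * ((τ - a) / (t - a)) ^ p) * M := by
          have := Real.multichoose_pos hs p
          gcongr
          exact hC p
      _ = _ := by ring
  · filter_upwards [hne] with τ hτt hτ using (hbound hτ hτt).summable
  · have hint : IntervalIntegrable (fun τ : ℝ => (t - τ) ^ (-s)) volume a t := by
      have h := (intervalIntegral.intervalIntegrable_rpow' (a := t - a) (b := t - t)
        (by linarith : -1 < -s)).comp_sub_left t
      simpa using h
    refine (hint.const_mul ((t - a) ^ (-r) * M * C * ((t - a) ^ (-s))⁻¹)).congr_ae ?_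
    rw [Filter.EventuallyEq, ae_restrict_iff' measurableSet_uIoc]
    filter_upwards [hne] with τ hτt hτ
    have hLs : (t - a) ^ (-s) ≠ 0 := (Real.rpow_pos_of_pos hL _).ne'
    rw [(hbound hτ hτt).tsum_eq, ← hpow (-s) hτ]
    field_simp
  · filter_upwards [hne] with τ hτt hτ
    rw [← hpow (-r) hτ]
    exact ((Real.hasSum_multichoose_mul_pow r (hu hτ hτt).2).mul_left _).mul_right _

/-- Termwise binomial expansion of the integral
`∫_a^t (t-τ)^{n-1-α} x^{(n)}(τ) dτ` into the convergent series
`(t-a)^{n-1-α} Σ_{p=0}^∞ (Γ(p-n+1+α)/(Γ(1-n+α) p! (t-a)^p))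
  ∫_a^t (τ-a)^p x^{(n)}(τ) dτ`. -/
theorem binomial_expansion_of_fractional_integral
    (n : ℕ) (hn : 1 ≤ n) (a b α : ℝ) (hab : a < b) (hα0 : 0 < α) (hα1 : α < 1)
    (x : ℝ → ℝ) (hx : ContDiffOn ℝ n x (Set.Icc a b))
    (t : ℝ) (ht : t ∈ Set.Ioo a b) :
    HasSum
      (fun p : ℕ =>
        (t - a) ^ ((n : ℝ) - 1 - α) *
          (Real.Gamma ((p : ℝ) - (n : ℝ) + 1 + α) /
            (Real.Gamma (1 - (n : ℝ) + α) * (p ! : ℝ) * (t - a) ^ (p : ℝ))) *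
          ∫ τ in a..t, (τ - a) ^ p * iteratedDerivWithin n x (Set.Icc a b) τ)
      (∫ τ in a..t,
        (t - τ) ^ ((n : ℝ) - 1 - α) * iteratedDerivWithin n x (Set.Icc a b) τ) := by
  have hL : 0 < t - a := sub_pos.mpr ht.1
  have hn' : (1 : ℝ) ≤ n := by exact_mod_cast hn
  have hf : ContinuousOn (iteratedDerivWithin n x (Set.Icc a b)) (Set.Icc a t) :=
    (hx.continuousOn_iteratedDerivWithin le_rfl (uniqueDiffOn_Icc hab)).mono
      (Set.Icc_subset_Icc_right ht.2.le)
  have hr (m : ℕ) : 1 - (n : ℝ) + α ≠ -m := by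
    intro h
    have h1 : ((n : ℤ) - 1 - m : ℝ) = α := by push_cast; linarith
    have h2 : (0 : ℝ) < ((n - 1 - m : ℤ) : ℝ) := by push_cast at h1 ⊢; linarith
    have h3 : ((n - 1 - m : ℤ) : ℝ) < (1 : ℤ) := by push_cast at h1 ⊢; linarith
    have h2' : (0 : ℤ) < n - 1 - m := by exact_mod_cast h2
    have h3' : (n - 1 - m : ℤ) < 1 := by exact_mod_cast h3
    omega
  have hexp : (n : ℝ) - 1 - α = -(1 - (n : ℝ) + α) := by ring
  convert intervalIntegral.hasSum_multichoose_integral (r := 1 - (n : ℝ) + α) ht.1 hα0 hα1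
    (by linarith) hf using 1
  · funext p
    rw [← intervalIntegral.integral_const_mul, ← Real.Gamma_natCast_add_div _ hr p, hexp,
      Real.rpow_natCast]
    congr 1
    funext τ
    rw [show (p : ℝ) - n + 1 + α = p + (1 - n + α) by ring, div_pow]
    ring
  · rw [hexp]
end
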